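/- arXiv:1002.3769 — 2 statements merged into one kernel-verified Lean document; each statement's English description precedes it below -/
import Mathlib

section
/- Let n ≥ 1 and let T be a tile system in the connected linear neighborhood N_n, with finite set of glues X. There exist a finite glue set X_μ, a tile system T_μ in neighborhood N_vN over X_μ, a scale s ≥ 1, a polyomino assignment φ of scale s from T to finite T_μ-ribbons, and a zipper-simulation ψ of T by T_μ; in particular every (T,N_n)-zipper is simulated by some T_μ-ribbon. -/
namespace Paper

open scoped Classical

abbrev Pos : Type := ℤ × ℤ

/-- The von Neumann neighborhood. -/
def Nvn : Set Pos := {(0, 1), (1, 0), (0, -1), (-1, 0)}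

/-- A neighborhood: a finite symmetric set of positions not containing the origin. -/
def IsNeighborhood (N : Set Pos) : Prop :=
  N.Finite ∧ (0, 0) ∉ N ∧ ∀ w ∈ N, -w ∈ N

/-- A tile over glues `X` and neighborhood `N` : a function from `N` to `X`. -/
abbrev Tile (X : Type) (N : Set Pos) : Type := {w : Pos // w ∈ N} → X

/-- Scaling a position by an integer. -/
def sc (s : ℤ) (u : Pos) : Pos := (s * u.1, s * u.2)

/-- Domain of a partial map on the plane. -/
def tdom {α : Type} (τ : Pos → Option α) : Set Pos := {p | τ p ≠ none}

/-- A (T,N)-tiling: a partial map to tiles of `T` such that all neighboring glues match. -/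
def IsTiling {X : Type} {N : Set Pos} (T : Set (Tile X N))
    (τ : Pos → Option (Tile X N)) : Prop :=
  (∀ p t, τ p = some t → t ∈ T) ∧
  (∀ p t, τ p = some t → ∀ w t', τ (p + w) = some t' →
    ∀ (hw : w ∈ N) (hw' : -w ∈ N), t ⟨w, hw⟩ = t' ⟨-w, hw'⟩)

def IsFiniteTiling {X : Type} {N : Set Pos} (T : Set (Tile X N))
    (τ : Pos → Option (Tile X N)) : Prop :=
  IsTiling T τ ∧ (tdom τ).Finite

/-- A partial map on the plane is total if it is defined everywhere. -/
def TotalDom {α : Type} (τ : Pos → Option α) : Prop := ∀ p, τ p ≠ none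

/-- A poly-tiling of scale `s`: a partial map from grid positions to finite tilings,
satisfying (i) each component is a finite tiling, (ii) translated domains are disjoint,
(iii) neighboring (after translation) tiles of two components have matching glues. -/
def IsPolyTiling {X : Type} {N : Set Pos} (T : Set (Tile X N)) (s : ℤ)
    (σ : Pos → Option (Pos → Option (Tile X N))) : Prop :=
  (∀ u τu, σ u = some τu → IsFiniteTiling T τu) ∧
  (∀ u v τu τv, u ≠ v → σ u = some τu → σ v = some τv →
    ∀ p, τu p ≠ none → ∀ q, τv q ≠ none → sc s u + p ≠ sc s v + q) ∧
  (∀ u u' τu τu', σ u = some τu → σ u' = some τu' →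
    ∀ v t, τu v = some t → ∀ v' t', τu' v' = some t' →
    ∀ (hw : (sc s u' + v') - (sc s u + v) ∈ N)
      (hw' : -((sc s u' + v') - (sc s u + v)) ∈ N),
      t ⟨(sc s u' + v') - (sc s u + v), hw⟩ =
        t' ⟨-((sc s u' + v') - (sc s u + v)), hw'⟩)

/-- The tiling induced by a poly-tiling: position `s•u + v` carries the tile `σ u v`. -/
noncomputable def induced {α : Type} (s : ℤ) (σ : Pos → Option (Pos → Option α)) :
    Pos → Option α := fun p =>
  if h : ∃ t, ∃ u τu v, σ u = some τu ∧ τu v = some t ∧ p = sc s u + v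
    then some h.choose else none

/-- Periodicity of a (partial) tiling, with horizontal and vertical periods. -/
def PeriodicT {α : Type} (τ : Pos → Option α) : Prop :=
  ∃ ph pv : ℤ, 0 < ph ∧ 0 < pv ∧
    ∀ (p : Pos) (a b : ℤ), τ p ≠ none →
      τ (p.1 + a * ph, p.2 + b * pv) ≠ none →
      τ p = τ (p.1 + a * ph, p.2 + b * pv)

def LineConvex {α : Type} (τ : Pos → Option α) : Prop :=
  ∀ x₁ x₂ x y : ℤ, τ (x₁, y) ≠ none → τ (x₂, y) ≠ none →
    x₁ < x → x < x₂ → τ (x, y) ≠ none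

def ColumnConvex {α : Type} (τ : Pos → Option α) : Prop :=
  ∀ x y₁ y₂ y : ℤ, τ (x, y₁) ≠ none → τ (x, y₂) ≠ none →
    y₁ < y → y < y₂ → τ (x, y) ≠ none

/-- 4-connectedness of a set of positions. -/
def ConnectedDom (D : Set Pos) : Prop :=
  ∀ p ∈ D, ∀ q ∈ D, ∃ (n : ℕ) (c : ℕ → Pos), c 0 = p ∧ c n = q ∧
    (∀ k ≤ n, c k ∈ D) ∧ ∀ k < n, c (k + 1) - c k ∈ Nvn

/-- The connected linear neighborhood `N_n`. -/
def Nlin (n : ℤ) : Set Pos := {w | w.2 = 0 ∧ 0 < |w.1| ∧ |w.1| ≤ n}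

/-- The rectangular neighborhood `N_{m,n}`. -/
def Nrect (m n : ℤ) : Set Pos := {w | |w.1| ≤ m ∧ |w.2| ≤ n ∧ w ≠ (0, 0)}

/-- A set of consecutive integers. -/
def IsInterval (I : Set ℤ) : Prop :=
  ∀ a b c : ℤ, a ∈ I → c ∈ I → a ≤ b → b ≤ c → b ∈ I

/-- A path: a map from a set of consecutive integers to the plane, consecutive
positions being (von Neumann) adjacent. -/
def IsPath (I : Set ℤ) (P : ℤ → Pos) : Prop :=
  IsInterval I ∧ ∀ i : ℤ, i ∈ I → i + 1 ∈ I → P (i + 1) - P i ∈ Nvn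

/-- A T-tiled path: a path together with a map from its range to tiles of `T`. -/
def IsTiledPath {X : Type} {N : Set Pos} (T : Set (Tile X N)) (I : Set ℤ)
    (P : ℤ → Pos) (r : Pos → Option (Tile X N)) : Prop :=
  IsPath I P ∧ tdom r = P '' I ∧ ∀ p t, r p = some t → t ∈ T

/-- A T-ribbon: an injective tiled path in which consecutive tiles stick. -/
def IsRibbon {X : Type} (T : Set (Tile X Nvn)) (I : Set ℤ) (P : ℤ → Pos)
    (r : Pos → Option (Tile X Nvn)) : Prop :=
  IsTiledPath T I P r ∧ (∀ i ∈ I, ∀ j ∈ I, P i = P j → i = j) ∧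
  (∀ i : ℤ, i ∈ I → i + 1 ∈ I → ∀ t t', r (P i) = some t → r (P (i + 1)) = some t' →
    ∀ (hv : P (i + 1) - P i ∈ Nvn) (hv' : -(P (i + 1) - P i) ∈ Nvn),
      t ⟨P (i + 1) - P i, hv⟩ = t' ⟨-(P (i + 1) - P i), hv'⟩)

/-- A (T,N)-zipper: an injective tiled path whose tile map is a (T,N)-tiling. -/
def IsZipper {X : Type} {N : Set Pos} (T : Set (Tile X N)) (I : Set ℤ)
    (P : ℤ → Pos) (r : Pos → Option (Tile X N)) : Prop :=
  IsTiledPath T I P r ∧ (∀ i ∈ I, ∀ j ∈ I, P i = P j → i = j) ∧ IsTiling T r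

/-- Bundled T-ribbons (tile system in the von Neumann neighborhood). -/
structure Ribbon (X : Type) (T : Set (Tile X Nvn)) : Type where
  I : Set ℤ
  P : ℤ → Pos
  r : Pos → Option (Tile X Nvn)
  isRibbon : IsRibbon T I P r

/-- A poly-ribbon of scale `s` with macro path `(J, Q)` and components `ρ`. -/
def IsPolyRibbon {X : Type} {T : Set (Tile X Nvn)} (s : ℤ) (J : Set ℤ)
    (Q : ℤ → Pos) (ρ : Pos → Option (Ribbon X T)) : Prop :=
  IsPath J Q ∧ (∀ i ∈ J, ∀ j ∈ J, Q i = Q j → i = j) ∧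
  tdom ρ = Q '' J ∧
  (∀ u R, ρ u = some R → R.I.Finite ∧ R.I.Nonempty) ∧
  (∀ u v R S, u ≠ v → ρ u = some R → ρ v = some S →
    ∀ p, R.r p ≠ none → ∀ q, S.r q ≠ none → sc s u + p ≠ sc s v + q) ∧
  (∀ j : ℤ, j ∈ J → j + 1 ∈ J → ∀ R₁ R₂, ρ (Q j) = some R₁ → ρ (Q (j + 1)) = some R₂ →
    ∀ m₁, IsGreatest R₁.I m₁ → ∀ m₂, IsLeast R₂.I m₂ →
      ((sc s (Q (j + 1)) + R₂.P m₂) - (sc s (Q j) + R₁.P m₁) ∈ Nvn ∧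
      ∀ t₁ t₂, R₁.r (R₁.P m₁) = some t₁ → R₂.r (R₂.P m₂) = some t₂ →
        ∀ (hv : (sc s (Q (j + 1)) + R₂.P m₂) - (sc s (Q j) + R₁.P m₁) ∈ Nvn)
          (hv' : -((sc s (Q (j + 1)) + R₂.P m₂) - (sc s (Q j) + R₁.P m₁)) ∈ Nvn),
          t₁ ⟨(sc s (Q (j + 1)) + R₂.P m₂) - (sc s (Q j) + R₁.P m₁), hv⟩ =
            t₂ ⟨-((sc s (Q (j + 1)) + R₂.P m₂) - (sc s (Q j) + R₁.P m₁)), hv'⟩))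

/-- A zipper-simulation of `T` (in neighborhood `N`) by `Tμ` (in the von Neumann
neighborhood), of scale `s`, consisting of a polyomino assignment `phi`, the
trimming map `chi` and the simulation map `psi`. -/
structure ZipperSimulation (X Xμ : Type) (N : Set Pos) (T : Set (Tile X N))
    (Tμ : Set (Tile Xμ Nvn)) (s : ℤ) : Type where
  hs : 1 ≤ s
  phi : Tile X N → Set (Ribbon Xμ Tμ)
  phi_fin : ∀ t, ∀ R ∈ phi t, R.I.Finite ∧ R.I.Nonempty
  phi_ref : ∀ t, ∀ R ∈ phi t, R.r (0, 0) ≠ none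
  phi_spec : ∀ t t', t ≠ t' → ∀ R ∈ phi t, ∀ S ∈ phi t',
    ∀ p q a b, R.r p = some a → S.r q = some b → a ≠ b
  chi : Ribbon Xμ Tμ → Pos → Option (Ribbon Xμ Tμ)
  chi_poly : ∀ R : Ribbon Xμ Tμ, ∃ J Q, IsPolyRibbon s J Q (chi R)
  chi_sub : ∀ R u S, chi R u = some S →
    (∃ t ∈ T, S ∈ phi t) ∧ ∀ p a, S.r p = some a → R.r (sc s u + p) = some a
  chi_max : ∀ (R : Ribbon Xμ Tμ) (t : Tile X N), t ∈ T → ∀ S ∈ phi t, ∀ u : Pos,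
    (∀ p a, S.r p = some a → R.r (sc s u + p) = some a) → chi R u ≠ none
  psi : Set ℤ → (ℤ → Pos) → (Pos → Option (Tile X N)) → Set (Pos → Option (Ribbon Xμ Tμ))
  psi_nonempty : ∀ I P r, IsZipper T I P r → (psi I P r).Nonempty
  psi_poly : ∀ I P r, IsZipper T I P r → ∀ ρ ∈ psi I P r, IsPolyRibbon s I P ρ
  psi_comp : ∀ I P r, IsZipper T I P r → ∀ ρ ∈ psi I P r,
    ∀ u t, r u = some t → ∀ S, ρ u = some S → S ∈ phi t
  psi_exists : ∀ R : Ribbon Xμ Tμ, ∃ I P r, IsZipper T I P r ∧ chi R ∈ psi I P r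
  psi_unique : ∀ (R : Ribbon Xμ Tμ) I P r I' P' r',
    IsZipper T I P r → IsZipper T I' P' r' →
    chi R ∈ psi I P r → chi R ∈ psi I' P' r' →
    r = r' ∧ ∃ d : ℤ, (∀ i, i ∈ I ↔ i + d ∈ I') ∧ ∀ i ∈ I, P' (i + d) = P i

/-- A tiling-simulation of `T` (in neighborhood `N`) by `Tμ` (in the von Neumann
neighborhood), of scale `s`, consisting of a polyomino assignment `phi`, the
trimming map `chi` and the simulation map `psi`. -/
structure TilingSimulation (X Xμ : Type) (N : Set Pos) (T : Set (Tile X N))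
    (Tμ : Set (Tile Xμ Nvn)) (s : ℤ) : Type where
  hs : 1 ≤ s
  phi : Tile X N → Set (Pos → Option (Tile Xμ Nvn))
  phi_fin : ∀ t, ∀ τ' ∈ phi t, IsFiniteTiling Tμ τ'
  phi_ref : ∀ t, ∀ τ' ∈ phi t, τ' (0, 0) ≠ none
  phi_spec : ∀ t t', t ≠ t' → ∀ τ₁ ∈ phi t, ∀ τ₂ ∈ phi t',
    ∀ p q a b, τ₁ p = some a → τ₂ q = some b → a ≠ b
  chi : (Pos → Option (Tile Xμ Nvn)) → Pos → Option (Pos → Option (Tile Xμ Nvn))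
  chi_poly : ∀ τ', IsTiling Tμ τ' → IsPolyTiling Tμ s (chi τ')
  chi_sub : ∀ τ' u σu, chi τ' u = some σu →
    (∃ t ∈ T, σu ∈ phi t) ∧ ∀ p a, σu p = some a → τ' (sc s u + p) = some a
  chi_max : ∀ (τ' : Pos → Option (Tile Xμ Nvn)) (t : Tile X N), t ∈ T →
    ∀ σu ∈ phi t, ∀ u : Pos,
    (∀ p a, σu p = some a → τ' (sc s u + p) = some a) → chi τ' u ≠ none
  psi : (Pos → Option (Tile X N)) → Set (Pos → Option (Pos → Option (Tile Xμ Nvn)))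
  psi_nonempty : ∀ τ, IsTiling T τ → (psi τ).Nonempty
  psi_poly : ∀ τ, IsTiling T τ → ∀ σ ∈ psi τ, IsPolyTiling Tμ s σ
  psi_dom : ∀ τ, IsTiling T τ → ∀ σ ∈ psi τ, ∀ u, σ u ≠ none ↔ τ u ≠ none
  psi_comp : ∀ τ, IsTiling T τ → ∀ σ ∈ psi τ,
    ∀ u t, τ u = some t → ∀ σu, σ u = some σu → σu ∈ phi t
  psi_recover : ∀ τ', IsTiling Tμ τ' → ∃! τ, IsTiling T τ ∧ chi τ' ∈ psi τ

/-- `S` is traversed from `a` to `b` by a self-avoiding chain of adjacent positions. -/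
def Route (S : Set Pos) (a b : Pos) : Prop :=
  ∃ l : List Pos, l.IsChain (fun p q => q - p ∈ Nvn) ∧ l.Nodup ∧ l.head? = some a ∧
    l.getLast? = some b ∧ ∀ p, p ∈ l ↔ p ∈ S

lemma mem_Nvn {d : Pos} :
    d ∈ Nvn ↔ d = (0, 1) ∨ d = (1, 0) ∨ d = (0, -1) ∨ d = (-1, 0) := by
  simp [Nvn]

lemma neg_mem_Nvn {d : Pos} (h : d ∈ Nvn) : -d ∈ Nvn := by
  rw [mem_Nvn] at *
  rcases h with rfl | rfl | rfl | rfl <;> simp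

lemma ne_neg_of_mem_Nvn {d : Pos} (h : d ∈ Nvn) : d ≠ -d := by
  rw [mem_Nvn] at h
  rcases h with rfl | rfl | rfl | rfl <;> simp [Prod.ext_iff]

lemma Route.single (a : Pos) : Route {a} a a := ⟨[a], by simp⟩

lemma Route.append {S S' : Set Pos} {a b c d : Pos} (h : Route S a b) (h' : Route S' c d)
    (hbc : c - b ∈ Nvn) (hd : ∀ p ∈ S, p ∉ S') : Route (S ∪ S') a d := by
  obtain ⟨l, h1, h2, h3, h4, h5⟩ := h
  obtain ⟨l', h1', h2', h3', h4', h5'⟩ := h'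
  refine ⟨l ++ l', ?_, ?_, ?_, ?_, ?_⟩
  · rw [List.isChain_append]
    refine ⟨h1, h1', ?_⟩
    rw [h4, h3']
    simpa using hbc
  · rw [List.nodup_append]
    refine ⟨h2, h2', ?_⟩
    rintro x hx y hy rfl
    exact hd x ((h5 x).1 hx) ((h5' x).1 hy)
  · simp [List.head?_append, h3]
  · simp [List.getLast?_append, h4']
  · intro p
    simp [h5, h5']

lemma Route.reverse {S : Set Pos} {a b : Pos} (h : Route S a b) : Route S b a := by
  obtain ⟨l, h1, h2, h3, h4, h5⟩ := h
  refine ⟨l.reverse, ?_, by simpa using h2, by simpa using h4, by simpa using h3, by simpa using h5⟩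
  rw [List.isChain_reverse]
  refine h1.imp ?_
  intro p q hpq
  have := neg_mem_Nvn hpq
  simpa using this

lemma Route.rightRun (a y : ℤ) (m : ℕ) :
    Route {p | p.2 = y ∧ a ≤ p.1 ∧ p.1 ≤ a + m} (a, y) (a + m, y) := by
  induction m with
  | zero =>
    convert Route.single (a, y) using 1
    · ext ⟨u, v⟩
      simp only [Set.mem_ofPred_eq, Set.mem_singleton_iff, Prod.mk.injEq]
      push_cast
      omega
    · simp
  | succ m ih =>
    convert ih.append (Route.single (a + m + 1, y)) ?_ ?_ using 1
    · ext ⟨u, v⟩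
      simp only [Set.mem_ofPred_eq, Set.mem_singleton_iff, Set.mem_union, Prod.mk.injEq]
      push_cast
      omega
    · push_cast
      simp [add_assoc]
    · simp [Nvn]
    · rintro ⟨u, v⟩ h
      simp only [Set.mem_ofPred_eq, Set.mem_singleton_iff, Prod.mk.injEq] at h ⊢
      omega

/-- The horizontal segment between columns `a` and `b` of row `y`. -/
def segment (a b y : ℤ) : Set Pos := {p | p.2 = y ∧ min a b ≤ p.1 ∧ p.1 ≤ max a b}

lemma Route.segment (a b y : ℤ) : Route (segment a b y) (a, y) (b, y) := by
  rcases le_total a b with h | h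
  · have := Route.rightRun a y (b - a).toNat
    rw [Int.toNat_of_nonneg (by omega)] at this
    simpa [Paper.segment, h] using this
  · have := (Route.rightRun b y (a - b).toNat).reverse
    rw [Int.toNat_of_nonneg (by omega)] at this
    simpa [Paper.segment, h] using this

/-- The staircase going up one row at a time, moving in row `y` from column `q y`
to column `q (y + 1)`. -/
def wall (q : ℕ → ℤ) (Y : ℕ) : Set Pos :=
  {p | ∃ y : ℕ, y < Y ∧ p ∈ segment (q y) (q (y + 1)) y}

lemma Route.wall (q : ℕ → ℤ) (Y : ℕ) :
    Route (wall q (Y + 1)) (q 0, 0) (q (Y + 1), Y) := by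
  induction Y with
  | zero =>
    convert Route.segment (q 0) (q 1) 0 using 1
    · ext p
      simp [Paper.wall]
    · simp
  | succ Y ih =>
    convert ih.append (Route.segment (q (Y + 1)) (q (Y + 2)) (Y + 1 : ℕ)) ?_ ?_ using 1
    · ext p
      constructor
      · rintro ⟨y, hy, hp⟩
        rcases Nat.lt_succ_iff_lt_or_eq.1 hy with h | rfl
        · exact Or.inl ⟨y, h, hp⟩
        · exact Or.inr hp
      · rintro (⟨y, hy, hp⟩ | hp)
        · exact ⟨y, by omega, hp⟩
        · exact ⟨Y + 1, by omega, hp⟩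
    · simp [Nvn]
    · rintro p ⟨y, hy, hp⟩ hp'
      have h1 := hp.1
      have h2 := hp'.1
      push_cast at h2
      omega

/-- The cell of a block of side `s` through which the side `d` is crossed. -/
def port (s : ℤ) (d : Pos) : Pos :=
  if d = (0, 1) then (0, s - 1) else if d = (1, 0) then (s - 1, s - 2)
  else if d = (0, -1) then (0, 0) else (0, s - 2)

lemma port_add {s : ℤ} {d : Pos} (hd : d ∈ Nvn) : port s d + d = sc s d + port s (-d) := by
  rw [mem_Nvn] at hd
  rcases hd with rfl | rfl | rfl | rfl <;> simp [port, sc, Prod.ext_iff] <;> ring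

/-- The positions a block polyomino may use, given its two walls. -/
def blockRegion (q₀ q₁ : ℕ → ℤ) (Y : ℕ) : Set Pos :=
  wall q₀ Y ∪ wall q₁ Y ∪ {p | p.2 = Y ∧ 0 ≤ p.1 ∧ p.1 ≤ Y + 1} ∪
    {p | p.2 = Y + 1 ∧ 0 ≤ p.1 ∧ p.1 ≤ 1}

lemma wall_snd {q : ℕ → ℤ} {Y : ℕ} {p : Pos} (h : p ∈ wall q Y) : 0 ≤ p.2 ∧ p.2 < Y := by
  obtain ⟨y, hy, hp⟩ := h
  have := hp.1
  omega

lemma exists_route_ports (q₀ q₁ : ℕ → ℤ) (Y : ℕ) (h00 : q₀ 0 = 0) (h0Y : q₀ (Y + 1) = 0)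
    (h10 : q₁ 0 = 1) (h1Y : q₁ (Y + 1) = 1)
    (hdisj : ∀ p ∈ wall q₀ (Y + 1), p ∉ wall q₁ (Y + 1)) (d d' : Pos) (hd : d ∈ Nvn)
    (hd' : d' ∈ Nvn) (hne : d ≠ d') :
    ∃ S, Route S (port (Y + 3) d) (port (Y + 3) d') ∧ wall q₀ (Y + 1) ⊆ S ∧
      S ⊆ blockRegion q₀ q₁ (Y + 1) := by
  have w0 : Route (wall q₀ (Y + 1)) (0, 0) (0, Y) := by
    simpa only [h00, h0Y] using Route.wall q₀ Y
  have w1 : Route (wall q₁ (Y + 1)) (1, 0) (1, Y) := by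
    simpa only [h10, h1Y] using Route.wall q₁ Y
  have u : Route (wall q₀ (Y + 1) ∪ wall q₁ (Y + 1)) (0, Y) (1, Y) :=
    w0.reverse.append w1 (by simp [Nvn]) hdisj
  have hu : ∀ p ∈ wall q₀ (Y + 1) ∪ wall q₁ (Y + 1), 0 ≤ p.2 ∧ p.2 < Y + 1 := by
    rintro p (hp | hp) <;> simpa using wall_snd hp
  have hw0 : ∀ p ∈ wall q₀ (Y + 1), 0 ≤ p.2 ∧ p.2 < Y + 1 := fun p hp => hu p (Or.inl hp)
  have key : ∀ d d' : Pos, (d, d') ∈ ({((0, -1), (0, 1)), ((0, -1), (-1, 0)),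
      ((0, -1), (1, 0)), ((-1, 0), (1, 0)), ((-1, 0), (0, 1)), ((0, 1), (1, 0))} :
        Set (Pos × Pos)) →
      ∃ S, Route S (port (Y + 3) d) (port (Y + 3) d') ∧ wall q₀ (Y + 1) ⊆ S ∧
        S ⊆ blockRegion q₀ q₁ (Y + 1) := by
    intro d d' h
    have top : ∀ {S : Set Pos} {p : Pos}, (∀ p ∈ S, 0 ≤ p.2 ∧ p.2 < (Y : ℤ) + 1) →
        p ∈ S → ¬ (p.2 = (Y : ℤ) + 1) := fun hS hp h => by have := hS _ hp; omega
    simp only [Set.mem_insert_iff, Set.mem_singleton_iff, Prod.mk.injEq] at h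
    have sub0 : wall q₀ (Y + 1) ⊆ blockRegion q₀ q₁ (Y + 1) :=
      fun p hp => Or.inl (Or.inl (Or.inl hp))
    have subu : wall q₀ (Y + 1) ∪ wall q₁ (Y + 1) ⊆ blockRegion q₀ q₁ (Y + 1) :=
      fun p hp => Or.inl (Or.inl hp)
    have run0 := Route.segment 0 ((Y : ℤ) + 2) (Y + 1)
    have run1 := Route.segment 1 ((Y : ℤ) + 2) (Y + 1)
    have hport0 : ∀ p ∈ segment 0 ((Y : ℤ) + 2) (Y + 1), p ∈ blockRegion q₀ q₁ (Y + 1) := by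
      rintro p ⟨h1, h2, h3⟩
      refine Or.inl (Or.inr ⟨by push_cast; omega, by omega, by push_cast; omega⟩)
    have hport1 : ∀ p ∈ segment 1 ((Y : ℤ) + 2) (Y + 1), p ∈ blockRegion q₀ q₁ (Y + 1) := by
      rintro p ⟨h1, h2, h3⟩
      refine Or.inl (Or.inr ⟨by push_cast; omega, by omega, by push_cast; omega⟩)
    have c0 : ((0, (Y : ℤ) + 1) : Pos) ∈ blockRegion q₀ q₁ (Y + 1) :=
      Or.inl (Or.inr ⟨by simp, by simp, by push_cast; omega⟩)
    have c1 : ((1, (Y : ℤ) + 1) : Pos) ∈ blockRegion q₀ q₁ (Y + 1) :=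
      Or.inl (Or.inr ⟨by simp, by simp, by push_cast; omega⟩)
    have c2 : ((0, (Y : ℤ) + 2) : Pos) ∈ blockRegion q₀ q₁ (Y + 1) :=
      Or.inr ⟨by push_cast; omega, by simp, by simp⟩
    have c3 : ((1, (Y : ℤ) + 2) : Pos) ∈ blockRegion q₀ q₁ (Y + 1) :=
      Or.inr ⟨by push_cast; omega, by simp, by simp⟩
    have e1 : (Y : ℤ) + 3 - 1 = Y + 2 := by ring
    have e2 : (Y : ℤ) + 3 - 2 = Y + 1 := by ring
    rcases h with ⟨rfl, rfl⟩ | ⟨rfl, rfl⟩ | ⟨rfl, rfl⟩ | ⟨rfl, rfl⟩ | ⟨rfl, rfl⟩ | ⟨rfl, rfl⟩ <;>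
      simp only [port, Prod.mk.injEq, reduceCtorEq, if_true, e1, e2] <;> norm_num
    · refine ⟨_, (w0.append (Route.single (0, (Y : ℤ) + 1)) (by simp [Nvn]) ?_).append
        (Route.single (0, (Y : ℤ) + 2)) (by simp [Nvn]) ?_, ?_, ?_⟩
      · rintro p hp rfl
        exact top hw0 hp rfl
      · rintro p (hp | hp) rfl
        · have := hw0 _ hp; dsimp at this; omega
        · simp at hp
      · exact fun p hp => Or.inl (Or.inl hp)
      · simp [Set.insert_subset_iff, *]
    · refine ⟨_, w0.append (Route.single (0, (Y : ℤ) + 1)) (by simp [Nvn]) ?_, ?_, ?_⟩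
      · rintro p hp rfl
        exact top hw0 hp rfl
      · exact fun p hp => Or.inl hp
      · simp [Set.insert_subset_iff, *]
    · refine ⟨_, w0.append run0 (by simp [Nvn]) ?_, ?_, ?_⟩
      · exact fun p hp hp' => top hw0 hp hp'.1
      · exact fun p hp => Or.inl hp
      · exact Set.union_subset sub0 hport0
    · refine ⟨_, ((Route.single (0, (Y : ℤ) + 1)).append u (by simp [Nvn]) ?_).append run1
        (by simp [Nvn]) ?_, ?_, ?_⟩
      · rintro p rfl hp
        exact top hu hp rfl
      · rintro p (rfl | hp) hp'
        · simp [segment] at hp'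
          omega
        · exact top hu hp hp'.1
      · exact fun p hp => Or.inl (Or.inr (Or.inl hp))
      · exact Set.union_subset (Set.union_subset (by simpa using c0) subu) hport1
    · refine ⟨_, ((((Route.single (0, (Y : ℤ) + 1)).append u (by simp [Nvn]) ?_).append
        (Route.single (1, (Y : ℤ) + 1)) (by simp [Nvn]) ?_).append
        (Route.single (1, (Y : ℤ) + 2)) (by simp [Nvn]) ?_).append
        (Route.single (0, (Y : ℤ) + 2)) (by simp [Nvn]) ?_, ?_, ?_⟩
      · rintro p rfl hp
        exact top hu hp rfl
      · rintro p (rfl | hp) hp'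
        · simp at hp'
        · rw [Set.mem_singleton_iff] at hp'
          exact top hu hp (by rw [hp'])
      · rintro p ((rfl | hp) | hp) hp'
        · simp at hp'
        · rw [Set.mem_singleton_iff] at hp'
          have := hu p hp
          rw [hp'] at this
          dsimp at this
          omega
        · simp_all
      · rintro p (((rfl | hp) | hp) | hp) hp'
        · simp at hp'
        · rw [Set.mem_singleton_iff] at hp'
          have := hu p hp
          rw [hp'] at this
          dsimp at this
          omega
        · simp_all
        · simp_all
      · exact fun p hp => Or.inl (Or.inl (Or.inl (Or.inr (Or.inl hp))))
      · refine Set.union_subset (Set.union_subset (Set.union_subset (Set.union_subset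
          ?_ subu) ?_) ?_) ?_ <;> simpa
    · refine ⟨_, (((Route.single (0, (Y : ℤ) + 2)).append
        (Route.single (0, (Y : ℤ) + 1)) (by simp [Nvn]) ?_).append u (by simp [Nvn]) ?_).append run1
        (by simp [Nvn]) ?_, ?_, ?_⟩
      · simp
      · rintro p (rfl | rfl) hp
        · have := hu _ hp
          dsimp at this
          omega
        · exact top hu hp rfl
      · rintro p ((rfl | rfl) | hp) hp'
        · simp [segment] at hp'
        · simp [segment] at hp'
          omega
        · exact top hu hp hp'.1
      · exact fun p hp => Or.inl (Or.inr (Or.inl hp))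
      · refine Set.union_subset (Set.union_subset (Set.union_subset ?_ ?_) subu) hport1 <;> simpa
  have key' : ∀ d d' : Pos, (d', d) ∈ ({((0, -1), (0, 1)), ((0, -1), (-1, 0)),
      ((0, -1), (1, 0)), ((-1, 0), (1, 0)), ((-1, 0), (0, 1)), ((0, 1), (1, 0))} :
        Set (Pos × Pos)) →
      ∃ S, Route S (port (Y + 3) d) (port (Y + 3) d') ∧ wall q₀ (Y + 1) ⊆ S ∧
        S ⊆ blockRegion q₀ q₁ (Y + 1) := by
    intro d d' h
    obtain ⟨S, h1, h2⟩ := key d' d h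
    exact ⟨S, h1.reverse, h2⟩
  rw [mem_Nvn] at hd hd'
  rcases hd with rfl | rfl | rfl | rfl <;> rcases hd' with rfl | rfl | rfl | rfl <;>
    first
    | exact absurd rfl hne
    | (apply key; simp; done)
    | (apply key'; simp)

lemma port_add_notMem_blockRegion {q₀ q₁ : ℕ → ℤ} {Y : ℕ} {d : Pos} (hd : d ∈ Nvn) :
    port (Y + 2) d + d ∉ blockRegion q₀ q₁ Y := by
  rw [mem_Nvn] at hd
  have hY : (Y : ℤ) + 2 - 2 = Y := by ring
  rintro (((h | h) | h) | h)
  · have := wall_snd h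
    rcases hd with rfl | rfl | rfl | rfl <;> simp [port] at this
  · have := wall_snd h
    rcases hd with rfl | rfl | rfl | rfl <;> simp [port] at this
  · rcases hd with rfl | rfl | rfl | rfl <;> simp [port] at h
  · rcases hd with rfl | rfl | rfl | rfl <;> simp [port] at h
    omega

/-- The column of a wall at height `z` of a layer of height `4 * M`: near the middle of the
layer the wall makes an excursion to the block `e` columns to the left. -/
def layerCol (s M K e c b z : ℤ) : ℤ :=
  if 2 * e + b < z ∧ z + 2 * e + b < 4 * M then
    -(s * e) - 2 * M * K + 2 * M * c + 2 * e + b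
  else b

lemma layerCol_lt {s M K e c b e' c' b' d i j : ℤ} (hs : 2 * M * K + 2 ≤ s) (he : 0 ≤ e)
    (heM : e < M) (hc : c < K) (hb : 0 ≤ b) (hb1 : b ≤ 1) (he' : 0 ≤ e')
    (hc' : 0 ≤ c') (hK : 0 < K) (hb' : 0 ≤ b')
    (hd : 0 ≤ d) (hij : i ≤ j + 1) (hji : j ≤ i + 1)
    (H : (d = e' - e ∧ c = c' ∧ 2 * e + b < 2 * e' + b') ∨ M ≤ d - e' + e) :
    layerCol s M K e c b i < layerCol s M K e' c' b' j + s * d := by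
  have hM : 0 < M := by omega
  have h1 : 2 * M * c + 2 * M ≤ 2 * M * K := by nlinarith
  have h2 : 0 ≤ 2 * M * c' := by positivity
  have h3 : 0 ≤ 2 * M * K := by positivity
  have h4 : 0 ≤ s * e := mul_nonneg (by omega) he
  have h5 : 0 ≤ s * d := mul_nonneg (by omega) hd
  unfold layerCol
  rcases H with ⟨rfl, rfl, H⟩ | H
  · have h6 : s * (e' - e) = s * e' - s * e := by ring
    rw [h6] at h5 ⊢
    rcases (show e' = e ∨ e < e' by omega) with rfl | h
    · split_ifs <;> omega
    · have : s * (e + 1) ≤ s * e' := mul_le_mul_of_nonneg_left h (by omega)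
      have h7 : s * (e + 1) = s * e + s := by ring
      split_ifs <;> omega
  · have h6 : s * (e' + 1) ≤ s * d := mul_le_mul_of_nonneg_left (by omega) (by omega)
    have h7 : s * (e' + 1) = s * e' + s := by ring
    have h8 : 0 ≤ s * e' := mul_nonneg (by omega) he'
    split_ifs <;> omega

/-- The columns of a wall made of layers, the excursions in the layer `β` being described by
`e β` and `c β`. -/
def wallCol (s : ℤ) (M : ℕ) (K : ℤ) (e c : ℕ → ℤ) (b : ℤ) (y : ℕ) : ℤ :=
  layerCol s M K (e (y / (4 * M))) (c (y / (4 * M))) b (y % (4 * M) : ℕ)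

section wallCol

variable {s : ℤ} {M : ℕ} {K : ℤ} {e c e' c' : ℕ → ℤ} {b b' : ℤ}

lemma wallCol_mul (he : ∀ β, 0 ≤ e β) (hb : 0 ≤ b) (β : ℕ) :
    wallCol s M K e c b (4 * M * β) = b := by
  have := he (4 * M * β / (4 * M))
  simp only [wallCol, layerCol, Nat.mul_mod_right]
  rw [if_neg]
  push_cast
  omega

lemma wallCol_succ (he : ∀ β, 0 ≤ e β) (hb : 0 ≤ b) (hM : 0 < M) (y : ℕ) :
    wallCol s M K e c b (y + 1) = layerCol s M K (e (y / (4 * M))) (c (y / (4 * M))) b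
      ((y % (4 * M) : ℕ) + 1) := by
  have hlt := Nat.mod_lt y (show 4 * M > 0 by omega)
  have hy := Nat.div_add_mod y (4 * M)
  rcases Nat.lt_or_ge (y % (4 * M) + 1) (4 * M) with h | h
  · have h1 : (y + 1) / (4 * M) = y / (4 * M) := by
      rw [Nat.div_eq_iff (by omega), mul_comm (y / (4 * M))]
      omega
    have h2 : (y + 1) % (4 * M) = y % (4 * M) + 1 := by
      have := Nat.div_add_mod (y + 1) (4 * M)
      rw [h1] at this
      omega
    simp only [wallCol, h1, h2]
    push_cast
    rfl
  · have h1 : y + 1 = 4 * M * (y / (4 * M) + 1) := by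
      rw [mul_add]; omega
    rw [h1, wallCol_mul he hb]
    have := he (y / (4 * M))
    rw [layerCol, if_neg]
    have : ((y % (4 * M) : ℕ) : ℤ) + 1 = 4 * M := by exact_mod_cast (by omega)
    omega

lemma wall_ne_wall_add {d : ℤ} (hM : 0 < M) (hs : 2 * M * K + 2 ≤ s)
    (he : ∀ β, 0 ≤ e β) (heM : ∀ β, e β < M) (hc : ∀ β, c β < K) (hb : 0 ≤ b) (hb1 : b ≤ 1)
    (he' : ∀ β, 0 ≤ e' β) (hc' : ∀ β, 0 ≤ c' β) (hK : 0 < K) (hb' : 0 ≤ b') (hd : 0 ≤ d)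
    (H : ∀ β, (d = e' β - e β ∧ c β = c' β ∧ 2 * e β + b < 2 * e' β + b') ∨
      M ≤ d - e' β + e β) {Y : ℕ} {p p' : Pos} (hp : p ∈ wall (wallCol s M K e c b) Y)
    (hp' : p' ∈ wall (wallCol s M K e' c' b') Y) : p ≠ p' + (s * d, 0) := by
  obtain ⟨y, hy, h1, h2, h3⟩ := hp
  obtain ⟨y', hy', h1', h2', h3'⟩ := hp'
  rintro rfl
  obtain rfl : y = y' := by
    simp only [Prod.snd_add, add_zero] at h1
    omega
  have L := fun i j (hi : i ≤ j + 1) (hj : j ≤ i + 1) =>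
    layerCol_lt (i := i) (j := j) hs (he (y / (4 * M))) (heM _) (hc _) hb hb1
      (he' (y / (4 * M))) (hc' _) hK hb' hd hi hj (H _)
  rw [wallCol_succ he hb hM] at h2 h3
  rw [wallCol_succ he' hb' hM] at h2' h3'
  rw [wallCol] at h2 h3 h2' h3'
  simp only [Prod.fst_add] at h2 h3
  have L1 := L (y % (4 * M) : ℕ) (y % (4 * M) : ℕ) (by omega) (by omega)
  have L2 := L (y % (4 * M) : ℕ) ((y % (4 * M) : ℕ) + 1) (by omega) (by omega)
  have L3 := L ((y % (4 * M) : ℕ) + 1) (y % (4 * M) : ℕ) (by omega) (by omega)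
  have L4 := L ((y % (4 * M) : ℕ) + 1) ((y % (4 * M) : ℕ) + 1) (by omega) (by omega)
  omega

lemma wall_disjoint_wall (hM : 0 < M) (hs : 2 * M * K + 2 ≤ s)
    (he : ∀ β, 0 ≤ e β) (heM : ∀ β, e β < M) (hc0 : ∀ β, 0 ≤ c β) (hc : ∀ β, c β < K)
    {Y : ℕ} {p : Pos} (hp : p ∈ wall (wallCol s M K e c 0) Y) :
    p ∉ wall (wallCol s M K e c 1) Y := by
  intro hp'
  have hK := (hc0 0).trans_lt (hc 0)
  refine wall_ne_wall_add (d := 0) hM hs he heM hc le_rfl zero_le_one he hc0 hK zero_le_one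
    le_rfl (fun β => Or.inl ⟨by simp, rfl, by omega⟩) hp hp' (by simp)

lemma blockRegion_ne_add {d : ℤ} {Y : ℕ} (hY : s = Y + 2) (hM : 0 < M) (hs : 2 * M * K + 2 ≤ s)
    (he : ∀ β, 0 ≤ e β) (heM : ∀ β, e β < M) (hc : ∀ β, c β < K)
    (he' : ∀ β, 0 ≤ e' β) (hc' : ∀ β, 0 ≤ c' β) (hK : 0 < K) (hd : 0 < d)
    (H : ∀ β, (d = e' β - e β ∧ c β = c' β) ∨ M ≤ d - e' β + e β) {p p' : Pos}
    (hp : p ∈ blockRegion (wallCol s M K e c 0) (wallCol s M K e c 1) Y)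
    (hp' : p' ∈ blockRegion (wallCol s M K e' c' 0) (wallCol s M K e' c' 1) Y) :
    p ≠ p' + (s * d, 0) := by
  have W : ∀ b b' : ℤ, 0 ≤ b → b ≤ 1 → 0 ≤ b' → b' ≤ 1 →
      p ∈ wall (wallCol s M K e c b) Y → p' ∈ wall (wallCol s M K e' c' b') Y →
      p ≠ p' + (s * d, 0) := fun b b' h0 h1 h0' h1' h h' =>
    wall_ne_wall_add hM hs he heM hc h0 h1 he' hc' hK h0' hd.le
      (fun β => (H β).imp_left fun ⟨h, h'⟩ => ⟨h, h', by omega⟩) h h'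
  have hlow : ∀ {q₀ q₁ : ℕ → ℤ} {p : Pos}, p ∈ blockRegion q₀ q₁ Y →
      (p ∈ wall q₀ Y ∨ p ∈ wall q₁ Y) ∧ p.2 < Y ∨
        (p.2 = Y ∨ p.2 = Y + 1) ∧ 0 ≤ p.1 ∧ p.1 ≤ Y + 1 := by
    rintro q₀ q₁ p (((h | h) | ⟨h1, h2, h3⟩) | ⟨h1, h2, h3⟩)
    · exact Or.inl ⟨Or.inl h, (wall_snd h).2⟩
    · exact Or.inl ⟨Or.inr h, (wall_snd h).2⟩
    · exact Or.inr ⟨Or.inl h1, h2, h3⟩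
    · exact Or.inr ⟨Or.inr h1, h2, by omega⟩
  intro hpp
  have h2 : p.2 = p'.2 := by simp [hpp]
  have h1 : p.1 = p'.1 + s * d := by simp [hpp]
  have hsd : s * 1 ≤ s * d := mul_le_mul_of_nonneg_left hd (by omega)
  rcases hlow hp with ⟨h, h3⟩ | ⟨h, h3⟩ <;> rcases hlow hp' with ⟨h', h3'⟩ | ⟨h', h3'⟩
  · rcases h with h | h <;> rcases h' with h' | h' <;> exact W _ _ (by simp) (by simp) (by simp) (by simp) h h' hpp
  all_goals omega

lemma blockRegion_snd {q₀ q₁ : ℕ → ℤ} {Y : ℕ} {p : Pos} (hp : p ∈ blockRegion q₀ q₁ Y) :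
    0 ≤ p.2 ∧ p.2 < Y + 2 := by
  rcases hp with ((h | h) | ⟨h1, h2, h3⟩) | ⟨h1, h2, h3⟩
  · have := wall_snd h; omega
  · have := wall_snd h; omega
  · omega
  · omega

/-- If the codes of a layer decrease from a block to another block having an excursion to it,
then the walls of these blocks cross. -/
lemma exists_mem_wall_add {β B : ℕ} (hβ : β < B) (hM : 0 < M) (hs : 2 * M * K + 2 ≤ s)
    (he0 : e β = 0) (he1 : ∀ β, 0 ≤ e β) (hc : c β < K) (he : ∀ β, 0 ≤ e' β)
    (hi : 0 < e' β) (hiM : e' β < M) (hcc : c' β < c β) (hc' : 0 ≤ c' β) :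
    ∃ p ∈ wall (wallCol s M K e c 0) (4 * M * B), ∃ p' ∈ wall (wallCol s M K e' c' 0) (4 * M * B),
      p = p' + (s * e' β, 0) := by
  obtain ⟨i, hi'⟩ := Int.eq_ofNat_of_zero_le hi.le
  have hdiv : (4 * M * β + 2 * i) / (4 * M) = β := by
    rw [Nat.div_eq_iff (by omega), mul_comm β]
    omega
  have hmod : (4 * M * β + 2 * i) % (4 * M) = 2 * i := by
    rw [Nat.mul_add_mod]
    exact Nat.mod_eq_of_lt (by omega)
  have hlt : 4 * M * β + 2 * i < 4 * M * B := by
    have : 4 * M * (β + 1) ≤ 4 * M * B := Nat.mul_le_mul_left _ hβ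
    have : 4 * M * (β + 1) = 4 * M * β + 4 * M := by ring
    omega
  have h1 : 2 * (M : ℤ) * c β + 2 * M ≤ 2 * M * K := by nlinarith
  have h2 : 2 * (M : ℤ) * c' β + 2 * M ≤ 2 * M * c β := by nlinarith
  have h3 : 0 ≤ 2 * (M : ℤ) * c' β := by positivity
  have h4 : 0 ≤ s * e' β := mul_nonneg (by omega) hi.le
  refine ⟨(-(2 * M * K) + 2 * M * c β, (4 * M * β + 2 * i : ℕ)), ⟨_, hlt, ?_⟩,
    (-(2 * M * K) + 2 * M * c β - s * e' β, (4 * M * β + 2 * i : ℕ)), ⟨_, hlt, ?_⟩, by simp⟩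
  · rw [wallCol_succ he1 le_rfl hM, wallCol, hdiv, hmod, he0]
    refine ⟨rfl, ?_⟩
    simp only [layerCol]
    push_cast
    rw [if_pos (by omega)]
    split_ifs <;> omega
  · rw [wallCol_succ he le_rfl hM, wallCol, hdiv, hmod]
    refine ⟨rfl, ?_⟩
    simp only [layerCol]
    push_cast
    rw [if_neg (by omega), if_pos (by omega)]
    omega

end wallCol

lemma exists_mem_Nvn_ne (a b : Pos) : ∃ w ∈ Nvn, w ≠ a ∧ w ≠ b := by
  by_contra! h
  have h1 := h (0, 1) (by simp [Nvn])
  have h2 := h (1, 0) (by simp [Nvn])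
  have h3 := h (0, -1) (by simp [Nvn])
  by_cases ha : ((0, 1) : Pos) = a
  · subst ha
    have := (h2 (by simp)).trans (h3 (by simp [Prod.ext_iff])).symm
    simp at this
  · have h1' := h1 ha
    subst h1'
    by_cases hb : ((1, 0) : Pos) = a
    · subst hb
      exact absurd (h3 (by simp)) (by simp [Prod.ext_iff])
    · exact absurd (h2 hb) (by simp)

lemma sc_add (s : ℤ) (u v : Pos) : sc s (u + v) = sc s u + sc s v := by
  simp [sc, mul_add]

lemma sc_injective {s : ℤ} (hs : 1 ≤ s) : Function.Injective (sc s) := by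
  rintro ⟨a, b⟩ ⟨c, d⟩ h
  simpa [sc, show s ≠ 0 by omega] using h

/-- A system of self-avoiding polyomino paths `pth v 0, …, pth v (len v - 1)`, each entering
its block through the side `inSide v` and leaving it through the side `outSide v`; the values
of `pth v` at `-1` and `len v` are the cells just outside the block. -/
structure Blocks (V C : Type) where
  s : ℤ
  one_le_s : 1 ≤ s
  len : V → ℤ
  len_pos : ∀ v, 0 < len v
  pth : V → ℤ → Pos
  inSide : V → Pos
  outSide : V → Pos
  inC : V → C
  outC : V → C
  inSide_mem : ∀ v, inSide v ∈ Nvn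
  outSide_mem : ∀ v, outSide v ∈ Nvn
  step : ∀ v i, -1 ≤ i → i < len v → pth v (i + 1) - pth v i ∈ Nvn
  inj : ∀ v i j, 0 ≤ i → i < len v → 0 ≤ j → j < len v → pth v i = pth v j → i = j
  turn : ∀ v i, 0 ≤ i → i < len v → pth v (i - 1) ≠ pth v (i + 1)
  pth_neg_one : ∀ v, pth v (-1) = pth v 0 + inSide v
  pth_len : ∀ v, pth v (len v) = pth v (len v - 1) + outSide v
  exists_pth_eq_zero : ∀ v, ∃ i, 0 ≤ i ∧ i < len v ∧ pth v i = 0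
  pth_len_eq : ∀ v v', outSide v = -inSide v' → pth v (len v) = sc s (outSide v) + pth v' 0

namespace Blocks

variable {V C : Type} (B : Blocks V C)

/-- The positions along the paths. -/
abbrev St : Type := Σ v, Set.Ico (0 : ℤ) (B.len v)

/-- The `i`-th position of the path `v`, if any. -/
noncomputable def st (v : V) (i : ℤ) : Option B.St :=
  if h : 0 ≤ i ∧ i < B.len v then some ⟨v, i, h⟩ else none

lemma st_inj {v v' : V} {i i' : ℤ} (h0 : 0 ≤ i) (h1 : i < B.len v) (h : B.st v i = B.st v' i') :
    v = v' ∧ i = i' := by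
  unfold st at h
  rw [dif_pos ⟨h0, h1⟩] at h
  split_ifs at h with h'
  simp only [Option.some.injEq, Sigma.mk.injEq] at h
  obtain ⟨rfl, h⟩ := h
  exact ⟨rfl, congrArg Subtype.val (eq_of_heq h)⟩

/-- The glues: unused sides, links along a path, and links between paths. -/
abbrev Glue (B : Blocks V C) : Type :=
  (Option B.St × {w : Pos // w ∈ Nvn}) ⊕ Option B.St ⊕ ({w : Pos // w ∈ Nvn} × C)

/-- The tile at the `i`-th position of the path `v`. -/
noncomputable def tile (v : V) (i : ℤ) : Tile B.Glue Nvn := fun w =>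
  if w.1 = B.pth v (i + 1) - B.pth v i then
    if i + 1 < B.len v then Sum.inr (Sum.inl (B.st v i)) else Sum.inr (Sum.inr (w, B.outC v))
  else if w.1 = B.pth v (i - 1) - B.pth v i then
    if 0 < i then Sum.inr (Sum.inl (B.st v (i - 1)))
    else Sum.inr (Sum.inr (⟨-w.1, neg_mem_Nvn w.2⟩, B.inC v))
  else Sum.inl (B.st v i, w)

lemma tile_inj {v v' : V} {i i' : ℤ} (h0 : 0 ≤ i) (h1 : i < B.len v)
    (h : B.tile v i = B.tile v' i') : v = v' ∧ i = i' := by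
  obtain ⟨w, hw, h2, h3⟩ := exists_mem_Nvn_ne (B.pth v (i + 1) - B.pth v i)
    (B.pth v (i - 1) - B.pth v i)
  have := congrFun h ⟨w, hw⟩
  unfold tile at this
  rw [if_neg h2, if_neg h3] at this
  split_ifs at this
  simp only [Sum.inl.injEq, Prod.mk.injEq, and_true] at this
  exact B.st_inj h0 h1 this

/-- The path `v'` may follow the path `v`. -/
def Link (v v' : V) : Prop := B.outSide v = -B.inSide v' ∧ B.outC v = B.inC v'

/-- The position `i'` of `v'` comes after the position `i` of `v`. -/
def Next (v : V) (i : ℤ) (v' : V) (i' : ℤ) : Prop :=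
  (i + 1 < B.len v ∧ v' = v ∧ i' = i + 1) ∨ (i + 1 = B.len v ∧ i' = 0 ∧ B.Link v v')

variable {B}

lemma Next.sub_eq {v v' : V} {i i' : ℤ} (h : B.Next v i v' i') :
    B.pth v (i + 1) - B.pth v i = -(B.pth v' (i' - 1) - B.pth v' i') := by
  rcases h with ⟨h, rfl, rfl⟩ | ⟨h, rfl, h'⟩
  · simp
  · have h1 := B.pth_len v
    have h2 := B.pth_neg_one v'
    obtain rfl : i = B.len v - 1 := by omega
    simp [h1, h2, h'.1]

lemma Next.tile_eq {v v' : V} {i i' : ℤ} (h : B.Next v i v' i') (hi : 0 ≤ i) (h0 : 0 ≤ i')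
    (h0' : i' < B.len v')
    (hw : B.pth v (i + 1) - B.pth v i ∈ Nvn) (hw' : -(B.pth v (i + 1) - B.pth v i) ∈ Nvn) :
    B.tile v i ⟨_, hw⟩ = B.tile v' i' ⟨_, hw'⟩ := by
  have h1 := h.sub_eq
  unfold tile
  have h2 : ¬ (-(B.pth v (i + 1) - B.pth v i) = B.pth v' (i' + 1) - B.pth v' i') := by
    rw [h1, neg_neg]
    intro h
    exact B.turn v' i' h0 h0' (sub_left_inj.1 h)
  have h3 : -(B.pth v (i + 1) - B.pth v i) = B.pth v' (i' - 1) - B.pth v' i' := by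
    rw [h1, neg_neg]
  rw [if_pos rfl, if_neg h2, if_pos h3]
  rcases h with ⟨h, rfl, rfl⟩ | ⟨h, rfl, h'⟩
  · simp [h, show 0 < i + 1 by omega]
  · simp [h, h'.2]

lemma next_of_tile_eq {v v' : V} {i i' : ℤ} (h0 : 0 ≤ i) (h1 : i < B.len v)
    (h0' : 0 ≤ i') (h1' : i' < B.len v') {w : Pos} (hw : w ∈ Nvn) (hw' : -w ∈ Nvn)
    (h : B.tile v i ⟨w, hw⟩ = B.tile v' i' ⟨-w, hw'⟩) :
    (w = B.pth v (i + 1) - B.pth v i ∧ -w = B.pth v' (i' - 1) - B.pth v' i' ∧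
      B.Next v i v' i') ∨
    (-w = B.pth v' (i' + 1) - B.pth v' i' ∧ w = B.pth v (i - 1) - B.pth v i ∧
      B.Next v' i' v i) := by
  have hne := ne_neg_of_mem_Nvn hw
  have ext1 : ∀ (v : V) (i : ℤ) (w : Pos), i < B.len v → ¬ i + 1 < B.len v →
      w = B.pth v (i + 1) - B.pth v i → w = B.outSide v := by
    rintro v i w h1 h2 rfl
    obtain rfl : i = B.len v - 1 := by omega
    simp [B.pth_len v]
  have ext2 : ∀ (v : V) (i : ℤ) (w : Pos), 0 ≤ i → ¬ 0 < i →
      w = B.pth v (i - 1) - B.pth v i → w = B.inSide v := by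
    rintro v i w h1 h2 rfl
    obtain rfl : i = 0 := by omega
    simp [B.pth_neg_one v]
  unfold tile at h
  dsimp only at h
  split_ifs at h with a1 a2 a3 a4 a5 a6 a7 a8 a9 b1 b2 b3 b4 b5 b6 b7 b8 b9 <;>
    simp only [Sum.inr.injEq, Sum.inl.injEq, reduceCtorEq, Prod.mk.injEq, Subtype.mk.injEq] at h
  · obtain ⟨rfl, rfl⟩ := B.st_inj h0 h1 h
    exact absurd (a1.trans a3.symm) hne
  · obtain ⟨rfl, rfl⟩ := B.st_inj h0 h1 h
    exact Or.inl ⟨a1, a5, Or.inl ⟨a2, rfl, by ring⟩⟩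
  · exact absurd h.1 hne
  · exact Or.inl ⟨a1, a9, Or.inr ⟨by omega, by omega,
      by rw [← ext1 v i w h1 a2 a1, ← ext2 v' i' (-w) h0' b1 a9, neg_neg], h.2⟩⟩
  · obtain ⟨rfl, rfl⟩ := B.st_inj (by omega) (by omega) h
    exact Or.inr ⟨b4, b2, Or.inl ⟨by omega, rfl, by ring⟩⟩
  · obtain ⟨rfl, h2⟩ := B.st_inj (by omega) (by omega) h
    obtain rfl : i = i' := by omega
    exact absurd (b2.trans b6.symm) hne
  · exact Or.inr ⟨b8, b2, Or.inr ⟨by omega, by omega,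
      by rw [← ext1 v' i' (-w) h1' b9 b8, ← ext2 v i w h0 b3 b2], h.2.symm⟩⟩
  · exact absurd (h.1.trans (neg_neg w)).symm hne
  · exact absurd h.2 hne

end Blocks

/-- The partial map on the plane carrying the value `t i` at the position `P i`, for `i ∈ I`. -/
noncomputable def place {α : Type} (I : Set ℤ) (P : ℤ → Pos) (t : ℤ → α) : Pos → Option α :=
  fun p => if h : ∃ i ∈ I, P i = p then some (t h.choose) else none

lemma place_eq_some {α : Type} {I : Set ℤ} {P : ℤ → Pos} {t : ℤ → α}
    (hP : ∀ i ∈ I, ∀ j ∈ I, P i = P j → i = j) {p : Pos} {x : α} :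
    place I P t p = some x ↔ ∃ i ∈ I, P i = p ∧ t i = x := by
  unfold place
  split_ifs with h
  · have h1 := h.choose_spec
    constructor
    · intro h2
      exact ⟨_, h1.1, h1.2, by simpa using h2⟩
    · rintro ⟨i, hi, hp, rfl⟩
      rw [hP i hi _ h1.1 (hp.trans h1.2.symm)]
  · simp only [false_iff]
    rintro ⟨i, hi, hp, -⟩
    exact h ⟨i, hi, hp⟩

lemma tdom_place {α : Type} (I : Set ℤ) (P : ℤ → Pos) (t : ℤ → α) :
    tdom (place I P t) = P '' I := by
  ext p
  by_cases h : ∃ i ∈ I, P i = p <;> simp [tdom, place, h]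

/-- There are sequences over the integers with prescribed increments. -/
lemma exists_add_eq (w : ℤ → ℤ) : ∃ S : ℤ → ℤ, ∀ i, S (i + 1) = S i + w i := by
  refine ⟨fun i => ∑ k ∈ Finset.range i.toNat, w k -
    ∑ k ∈ Finset.range (-i).toNat, w (-k - 1), fun i => ?_⟩
  obtain ⟨k, rfl | rfl⟩ := i.eq_nat_or_neg
  · have h1 : ((k : ℤ) + 1).toNat = k + 1 := by omega
    have h2 : (-((k : ℤ) + 1)).toNat = 0 := by omega
    have h3 : (-(k : ℤ)).toNat = 0 := by omega
    simp only [h1, h2, h3, Int.toNat_natCast, Finset.sum_range_succ, Finset.range_zero,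
      Finset.sum_empty]
    ring
  · cases k with
    | zero => simp
    | succ k =>
      have h1 : (-((k + 1 : ℕ) : ℤ) + 1).toNat = 0 := by omega
      have h2 : (-(-((k + 1 : ℕ) : ℤ) + 1)).toNat = k := by omega
      have h3 : (-((k + 1 : ℕ) : ℤ)).toNat = 0 := by omega
      have h4 : (- -((k + 1 : ℕ) : ℤ)).toNat = k + 1 := by omega
      simp only [h1, h2, h3, h4, Finset.sum_range_succ, Finset.range_zero, Finset.sum_empty]
      have : (-(k : ℤ) - 1) = -((k + 1 : ℕ) : ℤ) := by push_cast; ring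
      rw [this]
      ring

namespace Blocks

variable {V C : Type} (B : Blocks V C)

/-- The tile system of a system of blocks. -/
def tiles : Set (Tile B.Glue Nvn) := {t | ∃ v i, 0 ≤ i ∧ i < B.len v ∧ B.tile v i = t}

lemma tiles_finite [Finite V] : B.tiles.Finite := by
  have : B.tiles = Set.range fun q : B.St => B.tile q.1 q.2.1 := by
    ext t
    constructor
    · rintro ⟨v, i, h0, h1, rfl⟩
      exact ⟨⟨v, i, h0, h1⟩, rfl⟩
    · rintro ⟨⟨v, i, h0, h1⟩, rfl⟩
      exact ⟨v, i, h0, h1, rfl⟩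
  rw [this]
  exact Set.finite_range _

/-- The path `(I, P)`, oriented so that it follows the block paths, carries the tile number `p i`
of the block path `v i` at its `i`-th position. -/
structure IsTrace (I : Set ℤ) (P : ℤ → Pos) (v : ℤ → V) (p : ℤ → ℤ)
    (r : Pos → Option (Tile B.Glue Nvn)) : Prop where
  interval : IsInterval I
  inj : ∀ i ∈ I, ∀ j ∈ I, P i = P j → i = j
  dom : tdom r = P '' I
  nonneg : ∀ i ∈ I, 0 ≤ p i
  lt : ∀ i ∈ I, p i < B.len (v i)
  apply : ∀ i ∈ I, r (P i) = some (B.tile (v i) (p i))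
  add : ∀ i ∈ I, i + 1 ∈ I → P (i + 1) = P i + (B.pth (v i) (p i + 1) - B.pth (v i) (p i))
  next : ∀ i ∈ I, i + 1 ∈ I → B.Next (v i) (p i) (v (i + 1)) (p (i + 1))

variable {B}

lemma IsTrace.isRibbon {I : Set ℤ} {P : ℤ → Pos} {v : ℤ → V} {p : ℤ → ℤ}
    {r : Pos → Option (Tile B.Glue Nvn)} (h : B.IsTrace I P v p r) : IsRibbon B.tiles I P r := by
  refine ⟨⟨⟨h.interval, ?_⟩, h.dom, ?_⟩, h.inj, ?_⟩
  · intro i hi hi'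
    have := B.step (v i) (p i) (by have := h.nonneg i hi; omega) (h.lt i hi)
    simpa [h.add i hi hi'] using this
  · intro q t hq
    have : q ∈ P '' I := by rw [← h.dom]; simp [tdom, hq]
    obtain ⟨i, hi, rfl⟩ := this
    rw [h.apply i hi, Option.some.injEq] at hq
    exact ⟨_, _, h.nonneg i hi, h.lt i hi, hq⟩
  · intro i hi hi' t t' ht ht' hv hv'
    rw [h.apply i hi, Option.some.injEq] at ht
    rw [h.apply _ hi', Option.some.injEq] at ht'
    subst ht ht'
    have key : P (i + 1) - P i = B.pth (v i) (p i + 1) - B.pth (v i) (p i) := by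
      simp [h.add i hi hi']
    have := (h.next i hi hi').tile_eq (h.nonneg i hi) (h.nonneg _ hi') (h.lt _ hi')
      (key ▸ hv) (key ▸ hv')
    convert this using 2 <;> simp [key]

/-- The ribbon of a trace. -/
def IsTrace.ribbon {I : Set ℤ} {P : ℤ → Pos} {v : ℤ → V} {p : ℤ → ℤ}
    {r : Pos → Option (Tile B.Glue Nvn)} (h : B.IsTrace I P v p r) : Ribbon B.Glue B.tiles :=
  ⟨I, P, r, h.isRibbon⟩

variable (B)

lemma isTrace_pth (v : V) : B.IsTrace (Set.Ico 0 (B.len v)) (B.pth v) (fun _ => v) id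
    (place (Set.Ico 0 (B.len v)) (B.pth v) (B.tile v)) := by
  have hinj : ∀ i ∈ Set.Ico 0 (B.len v), ∀ j ∈ Set.Ico 0 (B.len v), B.pth v i = B.pth v j → i = j :=
    fun i hi j hj h => B.inj v i j hi.1 hi.2 hj.1 hj.2 h
  refine ⟨?_, hinj, tdom_place _ _ _, fun i hi => hi.1, fun i hi => hi.2, ?_, ?_, ?_⟩
  · rintro a b c ⟨ha, ha'⟩ ⟨hc, hc'⟩ h h'
    exact ⟨by omega, by omega⟩
  · intro i hi
    rw [place_eq_some hinj]
    exact ⟨i, hi, rfl, rfl⟩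
  · simp
  · intro i hi hi'
    exact Or.inl ⟨hi'.2, rfl, rfl⟩

/-- The ribbon along the path `v`. -/
noncomputable def rib (v : V) : Ribbon B.Glue B.tiles := (B.isTrace_pth v).ribbon

lemma rib_I (v : V) : (B.rib v).I = Set.Ico 0 (B.len v) := rfl

lemma rib_P (v : V) : (B.rib v).P = B.pth v := rfl

lemma rib_r_eq_some {v : V} {q : Pos} {t : Tile B.Glue Nvn} : (B.rib v).r q = some t ↔
    ∃ i, 0 ≤ i ∧ i < B.len v ∧ B.pth v i = q ∧ B.tile v i = t := by
  rw [show (B.rib v).r = place (Set.Ico 0 (B.len v)) (B.pth v) (B.tile v) from rfl,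
    place_eq_some (B.isTrace_pth v).inj]
  simp [and_assoc]

lemma eq_of_rib_r {v v' : V} {q q' : Pos} {t : Tile B.Glue Nvn} (h : (B.rib v).r q = some t)
    (h' : (B.rib v').r q' = some t) : v = v' := by
  rw [rib_r_eq_some] at h h'
  obtain ⟨i, h0, h1, -, rfl⟩ := h
  obtain ⟨i', -, -, -, h2⟩ := h'
  exact (B.tile_inj h0 h1 h2.symm).1

lemma rib_r_pth {v : V} {i : ℤ} (h0 : 0 ≤ i) (h1 : i < B.len v) :
    (B.rib v).r (B.pth v i) = some (B.tile v i) :=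
  B.rib_r_eq_some.2 ⟨i, h0, h1, rfl, rfl⟩

lemma rib_injective : Function.Injective B.rib := by
  intro v v' h
  have h1 := B.rib_r_pth (v := v) le_rfl (B.len_pos v)
  exact B.eq_of_rib_r h1 (h ▸ h1)

variable {B}

/-- Every nonempty ribbon can be oriented so that it follows the block paths. -/
lemma exists_isTrace (R : Ribbon B.Glue B.tiles) (hR : R.I.Nonempty) :
    ∃ I P v p, B.IsTrace I P v p R.r := by
  obtain ⟨⟨⟨hI, hadj⟩, hdom, hT⟩, hinj, hglue⟩ := R.isRibbon
  have ex : ∀ i, ∃ q : V × ℤ, i ∈ R.I → 0 ≤ q.2 ∧ q.2 < B.len q.1 ∧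
      R.r (R.P i) = some (B.tile q.1 q.2) := by
    have ex' : ∀ i ∈ R.I, ∃ q : V × ℤ, 0 ≤ q.2 ∧ q.2 < B.len q.1 ∧
        R.r (R.P i) = some (B.tile q.1 q.2) := by
      intro i hi
      have : R.P i ∈ tdom R.r := hdom ▸ ⟨i, hi, rfl⟩
      obtain ⟨t, ht⟩ := Option.ne_none_iff_exists'.1 this
      obtain ⟨v, k, h0, h1, rfl⟩ := hT _ _ ht
      exact ⟨(v, k), h0, h1, ht⟩
    intro i
    by_cases hi : i ∈ R.I
    · obtain ⟨q, hq⟩ := ex' i hi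
      exact ⟨q, fun _ => hq⟩
    · obtain ⟨i', hi'⟩ := hR
      obtain ⟨q, -⟩ := ex' i' hi'
      exact ⟨q, fun h => absurd h hi⟩
  choose q hq using ex
  let v := fun i => (q i).1
  let p := fun i => (q i).2
  let F : ℤ → Prop := fun i => R.P (i + 1) - R.P i = B.pth (v i) (p i + 1) - B.pth (v i) (p i) ∧
    R.P (i + 1) - R.P i = -(B.pth (v (i + 1)) (p (i + 1) - 1) - B.pth (v (i + 1)) (p (i + 1))) ∧
    B.Next (v i) (p i) (v (i + 1)) (p (i + 1))
  let G : ℤ → Prop := fun i =>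
    R.P (i + 1) - R.P i = -(B.pth (v (i + 1)) (p (i + 1) + 1) - B.pth (v (i + 1)) (p (i + 1))) ∧
    R.P (i + 1) - R.P i = B.pth (v i) (p i - 1) - B.pth (v i) (p i) ∧
    B.Next (v (i + 1)) (p (i + 1)) (v i) (p i)
  have hFG : ∀ i ∈ R.I, i + 1 ∈ R.I → F i ∨ G i := by
    intro i hi hi'
    have hw := hadj i hi hi'
    obtain ⟨h1, h2, h3⟩ := hq i hi
    obtain ⟨h1', h2', h3'⟩ := hq _ hi'
    rcases next_of_tile_eq h1 h2 h1' h2' hw (neg_mem_Nvn hw)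
      (hglue i hi hi' _ _ h3 h3' hw (neg_mem_Nvn hw)) with ⟨a, b, c⟩ | ⟨a, b, c⟩
    · exact Or.inl ⟨a, by rw [← b, neg_neg], c⟩
    · exact Or.inr ⟨by rw [← a, neg_neg], b, c⟩
  have back : ∀ i, i ∈ R.I → i + 1 + 1 ∈ R.I →
      R.P (i + 1 + 1) - R.P (i + 1) = -(R.P (i + 1) - R.P i) → False := by
    intro i hi hi' h
    have : i = i + 1 + 1 := hinj i hi _ hi' (by
      have : R.P (i + 1 + 1) = R.P (i + 1) + (R.P (i + 1 + 1) - R.P (i + 1)) := by abel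
      rw [this, h]
      abel)
    omega
  have hFF : ∀ i, i ∈ R.I → i + 1 ∈ R.I → i + 1 + 1 ∈ R.I → (F i ↔ F (i + 1)) := by
    intro i hi hi' hi''
    constructor
    · intro h
      refine (hFG _ hi' hi'').resolve_right fun h' => back i hi hi'' ?_
      rw [h'.2.1, h.2.1, neg_neg]
    · intro h
      refine (hFG _ hi hi').resolve_right fun h' => back i hi hi'' ?_
      rw [h'.1, h.1, neg_neg]
  have hall : (∀ i ∈ R.I, i + 1 ∈ R.I → F i) ∨ (∀ i ∈ R.I, i + 1 ∈ R.I → G i) := by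
    by_contra! hcon
    obtain ⟨⟨a, ha, ha', hFa⟩, ⟨b, hb, hb', hGb⟩⟩ := hcon
    have hFb := (hFG b hb hb').resolve_right hGb
    have run : ∀ k : ℕ, ∀ i, i ∈ R.I → i + k + 1 ∈ R.I → (F i ↔ F (i + k)) := by
      intro k
      induction k with
      | zero => simp
      | succ k ih =>
        intro i hi hk
        push_cast at hk ⊢
        have m1 : i + k ∈ R.I := hI i _ _ hi hk (by omega) (by omega)
        have m2 : i + k + 1 ∈ R.I := hI i _ _ hi hk (by omega) (by omega)
        rw [ih i hi m2, hFF _ m1 m2 (by simpa [add_assoc] using hk), add_assoc]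
    rcases le_total a b with h | h
    · have := run (b - a).toNat a ha (by rwa [Int.toNat_of_nonneg (by omega), add_sub_cancel])
      rw [Int.toNat_of_nonneg (by omega), add_sub_cancel] at this
      exact hFa (this.2 hFb)
    · have := run (a - b).toNat b hb (by rwa [Int.toNat_of_nonneg (by omega), add_sub_cancel])
      rw [Int.toNat_of_nonneg (by omega), add_sub_cancel] at this
      exact hFa (this.1 hFb)
  rcases hall with h | h
  · refine ⟨R.I, R.P, v, p, hI, hinj, hdom, fun i hi => (hq i hi).1, fun i hi => (hq i hi).2.1,
      fun i hi => (hq i hi).2.2, fun i hi hi' => ?_, fun i hi hi' => (h i hi hi').2.2⟩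
    rw [← (h i hi hi').1]
    abel
  · refine ⟨{i | -i ∈ R.I}, fun i => R.P (-i), fun i => v (-i), fun i => p (-i), ?_, ?_, ?_,
      fun i hi => (hq _ hi).1, fun i hi => (hq _ hi).2.1, fun i hi => (hq _ hi).2.2, ?_, ?_⟩
    · intro a b c ha hc h h'
      exact hI _ _ _ hc ha (by omega) (by omega)
    · intro i hi j hj hij
      have := hinj _ hi _ hj hij
      omega
    · rw [hdom]
      ext x
      constructor
      · rintro ⟨i, hi, rfl⟩
        exact ⟨-i, by simpa using hi, by simp⟩
      · rintro ⟨i, hi, rfl⟩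
        exact ⟨-i, hi, rfl⟩
    · intro i hi hi'
      have e : -(i + 1) + 1 = -i := by ring
      have := (h (-(i + 1)) hi' (by rw [e]; exact hi)).1
      rw [e] at this
      rw [← neg_eq_iff_eq_neg.2 this]
      abel
    · intro i hi hi'
      have e : -(i + 1) + 1 = -i := by ring
      have := (h (-(i + 1)) hi' (by rw [e]; exact hi)).2.2
      rwa [e] at this

end Blocks

namespace Blocks

variable {V C : Type} (B : Blocks V C)

/-- `r` contains the path `v` in the block `u`. -/
def Copy (r : Pos → Option (Tile B.Glue Nvn)) (v : V) (u : Pos) : Prop :=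
  ∀ i, 0 ≤ i → i < B.len v → r (sc B.s u + B.pth v i) = some (B.tile v i)

/-- The complete block paths contained in `r`. -/
noncomputable def copies (r : Pos → Option (Tile B.Glue Nvn)) (u : Pos) : Option V :=
  if h : ∃ v, B.Copy r v u then some h.choose else none

/-- The partial map `m` from blocks to block paths is a sequence of paths linked to one another. -/
structure IsBlockSeq (J : Set ℤ) (Q : ℤ → Pos) (m : Pos → Option V) : Prop where
  interval : IsInterval J
  inj : ∀ i ∈ J, ∀ j ∈ J, Q i = Q j → i = j
  dom : tdom m = Q '' J
  link : ∀ j ∈ J, j + 1 ∈ J → ∀ v v', m (Q j) = some v → m (Q (j + 1)) = some v' →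
    B.Link v v' ∧ Q (j + 1) = Q j + B.outSide v
  disjoint : ∀ u u' v v', u ≠ u' → m u = some v → m u' = some v' → ∀ i i', 0 ≤ i → i < B.len v →
    0 ≤ i' → i' < B.len v' → sc B.s u + B.pth v i ≠ sc B.s u' + B.pth v' i'

variable {B} {r : Pos → Option (Tile B.Glue Nvn)}

lemma Copy.eq {v v' : V} {u : Pos} (h : B.Copy r v u) (h' : B.Copy r v' u) : v = v' := by
  obtain ⟨i, h0, h1, hi⟩ := B.exists_pth_eq_zero v
  obtain ⟨i', h0', h1', hi'⟩ := B.exists_pth_eq_zero v'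
  have h2 := h i h0 h1
  have h3 := h' i' h0' h1'
  rw [hi] at h2
  rw [hi', h2, Option.some.injEq] at h3
  exact (B.tile_inj h0 h1 h3).1

lemma copies_eq_some {v : V} {u : Pos} : B.copies r u = some v ↔ B.Copy r v u := by
  unfold copies
  split_ifs with h
  · simp only [Option.some.injEq]
    exact ⟨fun h' => h' ▸ h.choose_spec, fun h' => h.choose_spec.eq h'⟩
  · simp only [false_iff]
    exact fun h' => h ⟨v, h'⟩

lemma Copy.disjoint {v v' : V} {u u' : Pos} (h : B.Copy r v u) (h' : B.Copy r v' u') (hu : u ≠ u')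
    {i i' : ℤ} (h0 : 0 ≤ i) (h1 : i < B.len v) (h0' : 0 ≤ i') (h1' : i' < B.len v') :
    sc B.s u + B.pth v i ≠ sc B.s u' + B.pth v' i' := by
  intro heq
  have h2 := h i h0 h1
  rw [heq, h' i' h0' h1', Option.some.injEq] at h2
  obtain ⟨rfl, rfl⟩ := B.tile_inj h0' h1' h2
  exact hu (sc_injective B.one_le_s (add_right_cancel heq))

lemma IsTrace.exists_eq {I : Set ℤ} {P : ℤ → Pos} {v : ℤ → V} {p : ℤ → ℤ}
    (h : B.IsTrace I P v p r) {x : Pos} {w : V} {i : ℤ} (h0 : 0 ≤ i) (h1 : i < B.len w)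
    (hx : r x = some (B.tile w i)) : ∃ a ∈ I, P a = x ∧ v a = w ∧ p a = i := by
  have : x ∈ P '' I := by rw [← h.dom]; simp [tdom, hx]
  obtain ⟨a, ha, rfl⟩ := this
  rw [h.apply a ha, Option.some.injEq] at hx
  obtain ⟨h2, h3⟩ := B.tile_inj h0 h1 hx.symm
  exact ⟨a, ha, rfl, h2.symm, h3.symm⟩

lemma IsTrace.add_nat {I : Set ℤ} {P : ℤ → Pos} {v : ℤ → V} {p : ℤ → ℤ}
    (h : B.IsTrace I P v p r) {a : ℤ} (ha : a ∈ I) (hp : p a = 0) (k : ℕ) (hk : k < B.len (v a))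
    (hak : a + k ∈ I) :
    p (a + k) = k ∧ v (a + k) = v a ∧ P (a + k) = P a + (B.pth (v a) k - B.pth (v a) 0) := by
  induction k with
  | zero => simp [hp]
  | succ k ih =>
    push_cast at hk hak ⊢
    rw [← add_assoc] at hak ⊢
    have hm : a + k ∈ I := h.interval a _ _ ha hak (by omega) (by omega)
    obtain ⟨h1, h2, h3⟩ := ih (by omega) hm
    have h4 := h.next _ hm hak
    have h5 := h.add _ hm hak
    rw [h1, h2] at h4 h5
    rcases h4 with ⟨-, h6, h7⟩ | ⟨h6, -⟩
    · refine ⟨h7, h6, ?_⟩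
      rw [h5, h3]
      abel
    · omega

lemma IsTrace.add_len {I : Set ℤ} {P : ℤ → Pos} {v : ℤ → V} {p : ℤ → ℤ}
    (h : B.IsTrace I P v p r) {a : ℤ} (ha : a ∈ I) (hp : p a = 0)
    (hb : a + B.len (v a) ∈ I) : p (a + B.len (v a)) = 0 ∧ B.Link (v a) (v (a + B.len (v a))) ∧
    P (a + B.len (v a)) = P a + sc B.s (B.outSide (v a)) +
      (B.pth (v (a + B.len (v a))) 0 - B.pth (v a) 0) := by
  have hpos := B.len_pos (v a)
  obtain ⟨k, hk⟩ := Int.eq_ofNat_of_zero_le (show 0 ≤ B.len (v a) - 1 by omega)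
  have hb' : a + B.len (v a) = a + k + 1 := by omega
  have hm : a + k ∈ I := h.interval a _ _ ha hb (by omega) (by omega)
  obtain ⟨h1, h2, h3⟩ := h.add_nat ha hp k (by omega) hm
  rw [hb'] at hb ⊢
  have h4 := h.next _ hm hb
  have h5 := h.add _ hm hb
  rw [h1, h2] at h4 h5
  rcases h4 with ⟨h6, -⟩ | ⟨h6, h7, h8⟩
  · omega
  · refine ⟨h7, h8, ?_⟩
    rw [h5, h3, h6, B.pth_len_eq _ _ h8.1]
    abel

lemma IsTrace.add_len_le {I : Set ℤ} {P : ℤ → Pos} {v : ℤ → V} {p : ℤ → ℤ}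
    (h : B.IsTrace I P v p r) {a b : ℤ} (ha : a ∈ I) (hp : p a = 0) (hb : b ∈ I) (hq : p b = 0)
    (hab : a < b) : a + B.len (v a) ≤ b := by
  by_contra! hlt
  obtain ⟨k, hk⟩ := Int.eq_ofNat_of_zero_le (show 0 ≤ b - a by omega)
  obtain rfl : b = a + k := by omega
  have := (h.add_nat ha hp k (by omega) hb).1
  omega

/-- The complete block paths contained in a ribbon form a sequence of linked paths. -/
lemma exists_isBlockSeq (R : Ribbon B.Glue B.tiles) : ∃ J Q, B.IsBlockSeq J Q (B.copies R.r) := by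
  have hdisj : ∀ u u' v v', u ≠ u' → B.copies R.r u = some v → B.copies R.r u' = some v' →
      ∀ i i', 0 ≤ i → i < B.len v → 0 ≤ i' → i' < B.len v' →
      sc B.s u + B.pth v i ≠ sc B.s u' + B.pth v' i' := by
    intro u u' v v' hu hv hv' i i' h0 h1 h0' h1'
    exact (copies_eq_some.1 hv).disjoint (copies_eq_some.1 hv') hu h0 h1 h0' h1'
  rcases R.I.eq_empty_or_nonempty with hI | hI
  · refine ⟨∅, fun _ => 0, fun _ _ _ h => h.elim, fun _ h => h.elim, ?_, fun _ h => h.elim, hdisj⟩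
    rw [Set.image_empty, Set.eq_empty_iff_forall_notMem]
    intro u hu
    obtain ⟨v, hv⟩ := Option.ne_none_iff_exists'.1 hu
    have h1 := copies_eq_some.1 hv 0 le_rfl (B.len_pos v)
    have h2 : sc B.s u + B.pth v 0 ∈ tdom R.r := by simp [tdom, h1]
    rw [R.isRibbon.1.2.1, hI] at h2
    simp at h2
  obtain ⟨I, P, v, p, tr⟩ := exists_isTrace R hI
  let A : ℤ → Pos → Prop := fun a u =>
    a ∈ I ∧ p a = 0 ∧ B.Copy R.r (v a) u ∧ P a = sc B.s u + B.pth (v a) 0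
  obtain ⟨N, hN⟩ := exists_add_eq fun a => if ∃ u, A a u then 1 else 0
  have hmono : Monotone N := by
    refine monotone_int_of_le_succ fun a => ?_
    rw [hN]
    split_ifs <;> omega
  have hlt : ∀ a u b, A a u → a < b → N a < N b := by
    intro a u b ha hab
    have := hmono (show a + 1 ≤ b by omega)
    rw [hN, if_pos ⟨u, ha⟩] at this
    omega
  have hinj : ∀ a u b u', A a u → A b u' → N a = N b → a = b := by
    intro a u b u' ha hb hab
    rcases lt_trichotomy a b with h | h | h
    · exact absurd (hlt a u b ha h) (by omega)
    · exact h
    · exact absurd (hlt b u' a hb h) (by omega)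
  have hex : ∀ j a, ∀ k : ℕ, N a ≤ j → j < N (a + k) → ∃ x u, A x u ∧ N x = j := by
    intro j a k
    induction k with
    | zero => intro h h'; simp at h'; omega
    | succ k ih =>
      intro h h'
      push_cast at h'
      rw [← add_assoc, hN] at h'
      rcases lt_or_ge j (N (a + k)) with h2 | h2
      · exact ih h h2
      · split_ifs at h' with hA
        · obtain ⟨u, hu⟩ := hA
          exact ⟨a + k, u, hu, by omega⟩
        · omega
  have : ∀ j, ∃ q : Pos, (∃ a u, A a u ∧ N a = j) → ∃ a, A a q ∧ N a = j := by
    intro j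
    by_cases h : ∃ a u, A a u ∧ N a = j
    · obtain ⟨a, u, hu, ha⟩ := h
      exact ⟨u, fun _ => ⟨a, hu, ha⟩⟩
    · exact ⟨0, fun h' => absurd h' h⟩
  choose Q hQ using this
  have huniq : ∀ a u u', A a u → A a u' → u = u' := by
    intro a u u' h h'
    have := h.2.2.2.symm.trans h'.2.2.2
    exact sc_injective B.one_le_s (add_right_cancel this)
  refine ⟨{j | ∃ a u, A a u ∧ N a = j}, Q, ?_, ?_, ?_, ?_, hdisj⟩
  · rintro i j k ⟨a, u, hu, ha⟩ ⟨c, u', hu', hc⟩ hij hjk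
    rcases hjk.lt_or_eq with h | h
    · have hac : a ≤ c := by
        by_contra! hca
        have := hmono hca.le
        omega
      refine hex j a (c - a).toNat (by omega) ?_
      rw [Int.toNat_of_nonneg (by omega), add_sub_cancel]
      omega
    · exact ⟨c, u', hu', by omega⟩
  · intro i hi j hj hij
    obtain ⟨a, ha, rfl⟩ := hQ i hi
    obtain ⟨b, hb, rfl⟩ := hQ j hj
    rw [hij] at ha
    have h1 := ha.2.2.1.eq hb.2.2.1
    have h2 := ha.2.2.2.trans (h1 ▸ hb.2.2.2.symm)
    rw [tr.inj a ha.1 b hb.1 h2]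
  · ext u
    constructor
    · intro hu
      obtain ⟨w, hw⟩ := Option.ne_none_iff_exists'.1 hu
      rw [copies_eq_some] at hw
      obtain ⟨a, ha, h1, h2, h3⟩ := tr.exists_eq le_rfl (B.len_pos w) (hw 0 le_rfl (B.len_pos w))
      have hA : A a u := ⟨ha, h3, h2 ▸ hw, h2 ▸ h1⟩
      refine ⟨N a, ⟨a, u, hA, rfl⟩, ?_⟩
      obtain ⟨b, hb, hba⟩ := hQ (N a) ⟨a, u, hA, rfl⟩
      rw [hinj b _ a _ hb hA hba] at hb
      exact huniq a _ _ hb hA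
    · rintro ⟨j, hj, rfl⟩
      obtain ⟨a, ha, rfl⟩ := hQ j hj
      show B.copies R.r _ ≠ none
      rw [copies_eq_some.2 ha.2.2.1]
      simp
  · intro j hj hj' w w' hw hw'
    obtain ⟨a, ha, haj⟩ := hQ j hj
    obtain ⟨b, hb, hbj⟩ := hQ _ hj'
    rw [copies_eq_some] at hw hw'
    obtain rfl := hw.eq ha.2.2.1
    obtain rfl := hw'.eq hb.2.2.1
    obtain ⟨haI, hpa, hca, hPa⟩ := ha
    obtain ⟨hbI, hpb, hcb, hPb⟩ := hb
    have hab : a < b := by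
      by_contra! hba
      have := hmono hba
      omega
    have hle := tr.add_len_le haI hpa hbI hpb hab
    have hpos := B.len_pos (v a)
    have hm : a + B.len (v a) ∈ I := tr.interval a _ _ haI hbI (by omega) hle
    obtain ⟨h1, h2, h3⟩ := tr.add_len haI hpa hm
    rcases hle.lt_or_eq with hlt' | heq
    · exfalso
      have hle' := tr.add_len_le hm h1 hbI hpb hlt'
      have hA : A (a + B.len (v a)) (Q j + B.outSide (v a)) := by
        have hP : P (a + B.len (v a)) =
            sc B.s (Q j + B.outSide (v a)) + B.pth (v (a + B.len (v a))) 0 := by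
          rw [h3, hPa, sc_add]
          abel
        refine ⟨hm, h1, fun i h0 h1' => ?_, hP⟩
        obtain ⟨k, rfl⟩ := Int.eq_ofNat_of_zero_le h0
        have hk : a + B.len (v a) + k ∈ I := tr.interval _ _ _ hm hbI (by omega) (by omega)
        obtain ⟨h4, h5, h6⟩ := tr.add_nat hm h1 k h1' hk
        have h7 := tr.apply _ hk
        rw [h4, h5, h6, hP] at h7
        rw [← h7]
        congr 1
        abel
      have h4 := hlt _ _ _ hA hlt'
      have h5 := hlt a (Q j) _ ⟨haI, hpa, hca, hPa⟩ (show a < a + B.len (v a) by omega)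
      omega
    · rw [heq] at h2 h3
      refine ⟨h2, sc_injective B.one_le_s ?_⟩
      have h4 := hPb.symm.trans h3
      rw [hPa] at h4
      rw [sc_add]
      have h5 := congrArg (fun x => x - B.pth (v b) 0) h4
      simp only [add_sub_cancel_right] at h5
      rw [h5]
      abel

end Blocks

namespace Blocks

variable {V C : Type} {B : Blocks V C} {J : Set ℤ} {Q : ℤ → Pos} {m : Pos → Option V}

lemma IsBlockSeq.apply_ne_none (h : B.IsBlockSeq J Q m) {j : ℤ} (hj : j ∈ J) : m (Q j) ≠ none := by
  have : Q j ∈ tdom m := h.dom ▸ ⟨j, hj, rfl⟩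
  exact this

lemma IsBlockSeq.exists_eq (h : B.IsBlockSeq J Q m) {u : Pos} {v : V} (hu : m u = some v) :
    ∃ j ∈ J, Q j = u := by
  have : u ∈ Q '' J := by rw [← h.dom]; simp [tdom, hu]
  exact this

/-- Concatenating a sequence of linked block paths yields a ribbon. -/
lemma IsBlockSeq.exists_copies_eq (h : B.IsBlockSeq J Q m) :
    ∃ R : Ribbon B.Glue B.tiles, B.copies R.r = m := by
  rcases J.eq_empty_or_nonempty with rfl | ⟨j₀, hj₀⟩
  · have hI : IsRibbon B.tiles ∅ (fun _ => 0) (fun _ => none) := by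
      refine ⟨⟨⟨fun _ _ _ h => h.elim, fun _ h => h.elim⟩, ?_, ?_⟩, fun _ h => h.elim,
        fun _ h => h.elim⟩
      · simp [tdom]
      · simp
    refine ⟨⟨_, _, _, hI⟩, funext fun u => ?_⟩
    have hm : m u = none := by
      by_contra hu
      have : u ∈ tdom m := hu
      simp [h.dom] at this
    rw [hm]
    by_contra hu
    obtain ⟨v, hv⟩ := Option.ne_none_iff_exists'.1 hu
    have := copies_eq_some.1 hv 0 le_rfl (B.len_pos v)
    simp at this
  obtain ⟨v₀, -⟩ := Option.ne_none_iff_exists'.1 (h.apply_ne_none hj₀)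
  have hw : ∀ j, ∃ v, j ∈ J → m (Q j) = some v := by
    intro j
    by_cases hj : j ∈ J
    · obtain ⟨v, hv⟩ := Option.ne_none_iff_exists'.1 (h.apply_ne_none hj)
      exact ⟨v, fun _ => hv⟩
    · exact ⟨v₀, fun h => absurd h hj⟩
  choose w hw using hw
  obtain ⟨S, hS⟩ := exists_add_eq fun j => B.len (w j)
  have hmono : StrictMono S := strictMono_int_of_lt_succ fun j => by
    have := B.len_pos (w j)
    rw [hS]
    omega
  have hdec : ∀ i, ∃ j, S j ≤ i ∧ i < S (j + 1) := by
    intro i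
    have hle : ∀ j, j ≤ i - S 0 → 0 ≤ i - S 0 ∨ S j ≤ i := by
      intro j hj
      by_cases hi : 0 ≤ i - S 0
      · exact Or.inl hi
      · right
        have : ∀ k : ℕ, S (-k) + k ≤ S 0 := by
          intro k
          induction k with
          | zero => simp
          | succ k ih =>
            have := hmono (show -((k + 1 : ℕ) : ℤ) < -(k : ℤ) by omega)
            push_cast at this ⊢
            omega
        have h1 := this (-j).toNat
        rw [show -((-j).toNat : ℤ) = j by omega] at h1
        omega
    have hbd : ∀ j, S j ≤ i → j ≤ max 0 (i - S 0) := by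
      intro j hj
      by_contra! hlt
      have : ∀ k : ℕ, S 0 + k ≤ S k := by
        intro k
        induction k with
        | zero => simp
        | succ k ih =>
          have := hmono (show (k : ℤ) < (k + 1 : ℕ) by omega)
          push_cast at this ⊢
          omega
      have h1 := this j.toNat
      rw [show (j.toNat : ℤ) = j by omega] at h1
      omega
    have hne : ∃ j, S j ≤ i := by
      rcases le_or_gt 0 (i - S 0) with hi | hi
      · exact ⟨0, by omega⟩
      · exact ⟨i - S 0, (hle _ le_rfl).resolve_left (by omega)⟩
    obtain ⟨j, hj, hmax⟩ := Int.exists_greatest_of_bdd ⟨_, hbd⟩ hne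
    refine ⟨j, hj, ?_⟩
    by_contra! hcon
    have := hmax _ hcon
    omega
  choose c hc using hdec
  have hcu : ∀ i j, S j ≤ i → i < S (j + 1) → c i = j := by
    intro i j h1 h2
    obtain ⟨h3, h4⟩ := hc i
    have h5 := hmono.lt_iff_lt.1 (h1.trans_lt h4)
    have h6 := hmono.lt_iff_lt.1 (h3.trans_lt h2)
    omega
  have hcm : Monotone c := by
    intro a b hab
    have := hmono.lt_iff_lt.1 (((hc a).1.trans hab).trans_lt (hc b).2)
    omega
  let I : Set ℤ := {i | c i ∈ J}
  let P : ℤ → Pos := fun i => sc B.s (Q (c i)) + B.pth (w (c i)) (i - S (c i))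
  let p : ℤ → ℤ := fun i => i - S (c i)
  let v : ℤ → V := fun i => w (c i)
  have hp0 : ∀ i, 0 ≤ p i := fun i => by have := (hc i).1; simp only [p]; omega
  have hp1 : ∀ i, p i < B.len (v i) := fun i => by
    have := (hc i).2
    rw [hS] at this
    simp only [p, v]
    omega
  have hPinj : ∀ i ∈ I, ∀ j ∈ I, P i = P j → i = j := by
    intro i hi j hj hij
    have hQ : Q (c i) = Q (c j) := by
      by_contra hne
      exact h.disjoint _ _ _ _ hne (hw _ hi) (hw _ hj) _ _ (hp0 i) (hp1 i) (hp0 j) (hp1 j) hij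
    have hcij := h.inj _ hi _ hj hQ
    have h2 : B.pth (v i) (p i) = B.pth (v i) (p j) := by
      have : P i = P j := hij
      simp only [P, ← hcij] at this
      simpa only [p, v, ← hcij] using add_left_cancel this
    have h3 := B.inj _ _ _ (hp0 i) (hp1 i) (hp0 j) (by
      have := hp1 j
      simpa only [v, ← hcij] using this) h2
    simp only [p, ← hcij] at h3
    omega
  have hnext : ∀ i ∈ I, i + 1 ∈ I → (c (i + 1) = c i ∧ p (i + 1) = p i + 1 ∧ p i + 1 < B.len (v i)) ∨
      (c (i + 1) = c i + 1 ∧ p (i + 1) = 0 ∧ p i + 1 = B.len (v i)) := by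
    intro i hi hi'
    have h1 := hc i
    have h2 := hS (c i)
    rcases lt_or_ge (i + 1) (S (c i + 1)) with hlt | hge
    · left
      have := hcu (i + 1) (c i) (by omega) hlt
      simp only [p, v, this, true_and]
      omega
    · right
      have h3 := hmono (show c i + 1 < c i + 1 + 1 by omega)
      have := hcu (i + 1) (c i + 1) hge (by omega)
      simp only [p, v, this, true_and]
      omega
  have tr : B.IsTrace I P v p (place I P fun i => B.tile (v i) (p i)) := by
    refine ⟨?_, hPinj, tdom_place _ _ _, fun i _ => hp0 i, fun i _ => hp1 i, ?_, ?_, ?_⟩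
    · intro a b d ha hd hab hbd
      exact h.interval _ _ _ ha hd (hcm hab) (hcm hbd)
    · intro i hi
      rw [place_eq_some hPinj]
      exact ⟨i, hi, rfl, rfl⟩
    · intro i hi hi'
      have hPi : P i = sc B.s (Q (c i)) + B.pth (v i) (p i) := rfl
      have hPi' : P (i + 1) = sc B.s (Q (c (i + 1))) + B.pth (v (i + 1)) (p (i + 1)) := rfl
      rw [hPi, hPi']
      rcases hnext i hi hi' with ⟨h1, h2, h3⟩ | ⟨h1, h2, h3⟩
      · simp only [v, h1, h2]
        abel
      · have hl := h.link (c i) hi (h1 ▸ hi') _ _ (hw _ hi) (hw _ (h1 ▸ hi'))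
        rw [h3, B.pth_len_eq _ _ hl.1.1, h2]
        simp only [v]
        rw [h1, hl.2, sc_add]
        abel
    · intro i hi hi'
      rcases hnext i hi hi' with ⟨h1, h2, h3⟩ | ⟨h1, h2, h3⟩
      · exact Or.inl ⟨h3, by simp only [v, h1], h2⟩
      · refine Or.inr ⟨h3, h2, ?_⟩
        have hl := h.link (c i) hi (h1 ▸ hi') _ _ (hw _ hi) (hw _ (h1 ▸ hi'))
        simp only [v, h1]
        exact hl.1
  refine ⟨tr.ribbon, funext fun u => Option.ext fun x => ?_⟩
  show B.copies (place I P fun i => B.tile (v i) (p i)) u = some x ↔ _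
  rw [copies_eq_some]
  constructor
  · intro hx
    obtain ⟨i, hi, h1, rfl, h3⟩ := tr.exists_eq le_rfl (B.len_pos x) (hx 0 le_rfl (B.len_pos x))
    have hPi : P i = sc B.s (Q (c i)) + B.pth (v i) (p i) := rfl
    rw [hPi, h3] at h1
    rw [← sc_injective B.one_le_s (add_right_cancel h1)]
    exact hw _ hi
  · intro hx k h0 h1
    obtain ⟨j, hj, rfl⟩ := h.exists_eq hx
    obtain rfl : w j = x := by
      have := hw j hj
      rw [hx] at this
      exact (Option.some.inj this).symm
    have hck := hcu (S j + k) j (by omega) (by rw [hS]; omega)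
    rw [place_eq_some hPinj]
    refine ⟨S j + k, show c _ ∈ J from hck.symm ▸ hj, ?_, ?_⟩
    · simp only [P, hck, add_sub_cancel_left]
    · simp only [v, p, hck, add_sub_cancel_left]

lemma IsBlockSeq.isPolyRibbon (h : B.IsBlockSeq J Q m) :
    IsPolyRibbon B.s J Q fun u => (m u).map B.rib := by
  refine ⟨⟨h.interval, ?_⟩, h.inj, ?_, ?_, ?_, ?_⟩
  · intro j hj hj'
    obtain ⟨v, hv⟩ := Option.ne_none_iff_exists'.1 (h.apply_ne_none hj)
    obtain ⟨v', hv'⟩ := Option.ne_none_iff_exists'.1 (h.apply_ne_none hj')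
    rw [(h.link j hj hj' _ _ hv hv').2]
    simpa using B.outSide_mem v
  · rw [← h.dom]
    simp [tdom]
  · intro u R hR
    obtain ⟨v, -, rfl⟩ := Option.map_eq_some_iff.1 hR
    rw [rib_I]
    exact ⟨Set.finite_Ico _ _, ⟨0, le_rfl, B.len_pos v⟩⟩
  · intro u u' R R' hu hR hR' q hq q' hq'
    obtain ⟨v, hv, rfl⟩ := Option.map_eq_some_iff.1 hR
    obtain ⟨v', hv', rfl⟩ := Option.map_eq_some_iff.1 hR'
    obtain ⟨t, ht⟩ := Option.ne_none_iff_exists'.1 hq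
    obtain ⟨t', ht'⟩ := Option.ne_none_iff_exists'.1 hq'
    obtain ⟨i, h0, h1, rfl, -⟩ := B.rib_r_eq_some.1 ht
    obtain ⟨i', h0', h1', rfl, -⟩ := B.rib_r_eq_some.1 ht'
    exact h.disjoint _ _ _ _ hu hv hv' _ _ h0 h1 h0' h1'
  · intro j hj hj' R R' hR hR' a ha b hb
    obtain ⟨v, hv, rfl⟩ := Option.map_eq_some_iff.1 hR
    obtain ⟨v', hv', rfl⟩ := Option.map_eq_some_iff.1 hR'
    have hpos := B.len_pos v
    have hpos' := B.len_pos v'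
    obtain rfl : a = B.len v - 1 := by
      have h1 := ha.1
      have h2 := ha.2 (show B.len v - 1 ∈ (B.rib v).I from ⟨by omega, by omega⟩)
      have := h1.2
      omega
    obtain rfl : b = 0 := by
      have h1 := hb.1.1
      have h2 := hb.2 (show (0 : ℤ) ∈ (B.rib v').I from ⟨le_rfl, hpos'⟩)
      omega
    obtain ⟨hl, hQ⟩ := h.link j hj hj' _ _ hv hv'
    simp only [rib_P]
    have key : (sc B.s (Q (j + 1)) + B.pth v' 0) - (sc B.s (Q j) + B.pth v (B.len v - 1)) =
        B.pth v (B.len v - 1 + 1) - B.pth v (B.len v - 1) := by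
      rw [hQ, sc_add, sub_add_cancel, B.pth_len_eq _ _ hl.1]
      abel
    refine ⟨key ▸ B.step v _ (by omega) (by omega), fun t t' ht ht' hw hw' => ?_⟩
    rw [B.rib_r_pth (by omega) (by omega), Option.some.injEq] at ht ht'
    subst ht ht'
    have hn : B.Next v (B.len v - 1) v' 0 := Or.inr ⟨by omega, rfl, hl⟩
    have := hn.tile_eq (by omega) le_rfl hpos' (key ▸ hw) (key ▸ hw')
    convert this using 2 <;> simp [key]

end Blocks

lemma Route.exists_path {S : Set Pos} {a b : Pos} (h : Route S a b) :
    ∃ (n : ℤ) (f : ℤ → Pos), 0 < n ∧ f 0 = a ∧ f (n - 1) = b ∧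
      (∀ i, 0 ≤ i → i + 1 < n → f (i + 1) - f i ∈ Nvn) ∧
      (∀ i j, 0 ≤ i → i < n → 0 ≤ j → j < n → f i = f j → i = j) ∧
      ∀ p, p ∈ S ↔ ∃ i, 0 ≤ i ∧ i < n ∧ f i = p := by
  obtain ⟨l, hchain, hnodup, hhead, hlast, hmem⟩ := h
  have hne : l ≠ [] := by rintro rfl; simp at hhead
  have hpos : 0 < l.length := List.length_pos_iff.2 hne
  have hget : ∀ i : ℤ, 0 ≤ i → ∀ hi : i.toNat < l.length, l.getD i.toNat a = l[i.toNat] :=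
    fun i _ hi => List.getD_eq_getElem _ _ hi
  refine ⟨l.length, fun i => l.getD i.toNat a, by exact_mod_cast hpos, ?_, ?_, ?_, ?_, ?_⟩
  · show l.getD (0 : ℤ).toNat a = a
    rw [hget 0 le_rfl hpos]
    rw [List.head?_eq_getElem?] at hhead
    exact (List.getElem?_eq_some_iff.1 hhead).2
  · have h1 : ((l.length : ℤ) - 1).toNat = l.length - 1 := by omega
    simp only [h1]
    rw [List.getD_eq_getElem _ _ (by omega)]
    rw [List.getLast?_eq_getElem?] at hlast
    exact (List.getElem?_eq_some_iff.1 hlast).2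
  · intro i h0 h1
    have h2 : (i + 1).toNat = i.toNat + 1 := by omega
    simp only [h2]
    rw [List.getD_eq_getElem _ _ (by omega), List.getD_eq_getElem _ _ (by omega)]
    exact List.isChain_iff_getElem.1 hchain _ (by omega)
  · intro i j h0 h1 h0' h1' hij
    dsimp only at hij
    rw [hget i h0 (by omega), hget j h0' (by omega)] at hij
    have := (List.Nodup.getElem_inj_iff hnodup).1 hij
    omega
  · intro p
    rw [← hmem, List.mem_iff_getElem]
    constructor
    · rintro ⟨i, hi, rfl⟩
      refine ⟨i, by omega, by exact_mod_cast hi, ?_⟩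
      simp [hi]
    · rintro ⟨i, h0, h1, rfl⟩
      exact ⟨i.toNat, by omega, (hget i h0 (by omega)).symm⟩

/-- Routes between the ports of blocks form a system of blocks. -/
lemma exists_blocks {V C : Type} {s : ℤ} (hs : 1 ≤ s) (inSide outSide : V → Pos) (inC outC : V → C)
    (S : V → Set Pos) (hin : ∀ v, inSide v ∈ Nvn) (hout : ∀ v, outSide v ∈ Nvn)
    (hne : ∀ v, inSide v ≠ outSide v)
    (hS : ∀ v, Route (S v) (port s (inSide v)) (port s (outSide v))) (h0 : ∀ v, 0 ∈ S v)
    (hport : ∀ v, ∀ d ∈ Nvn, port s d + d ∉ S v) :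
    ∃ B : Blocks V C, B.s = s ∧ B.inSide = inSide ∧ B.outSide = outSide ∧ B.inC = inC ∧
      B.outC = outC ∧ ∀ v p, p ∈ S v ↔ ∃ i, 0 ≤ i ∧ i < B.len v ∧ B.pth v i = p := by
  choose n f hn hf0 hfn hstep hinj hmem using fun v => (hS v).exists_path
  let g : V → ℤ → Pos := fun v i => if i < 0 then port s (inSide v) + inSide v
    else if i < n v then f v i else port s (outSide v) + outSide v
  have g1 : ∀ v i, 0 ≤ i → i < n v → g v i = f v i := fun v i h h' => by
    simp only [g, not_lt.2 h, h', if_true, if_false]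
  have g2 : ∀ v, g v (-1) = port s (inSide v) + inSide v := fun v => by simp [g]
  have g3 : ∀ v, g v (n v) = port s (outSide v) + outSide v := fun v => by
    simp [g, not_lt.2 (hn v).le]
  have hfS : ∀ v i, 0 ≤ i → i < n v → f v i ∈ S v := fun v i h h' => (hmem v _).2 ⟨i, h, h', rfl⟩
  have hfn' : ∀ v i, i + 1 = n v → f v i = port s (outSide v) := fun v i hi => by
    rw [← hfn, ← hi, add_sub_cancel_right]
  refine ⟨⟨s, hs, n, hn, g, inSide, outSide, inC, outC, hin, hout, ?_, ?_, ?_, ?_, ?_, ?_, ?_⟩,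
    rfl, rfl, rfl, rfl, rfl, ?_⟩
  · intro v i h h'
    rcases h.lt_or_eq with h1 | rfl
    · rcases (show i + 1 ≤ n v by omega).lt_or_eq with h2 | h2
      · rw [g1 v _ (by omega) h2, g1 v _ (by omega) h']
        exact hstep v i (by omega) h2
      · rw [h2, g3, g1 v _ (by omega) h', hfn' v i h2]
        simpa using hout v
    · rw [show (-1 : ℤ) + 1 = 0 from rfl, g2, g1 v _ le_rfl (hn v), hf0]
      simpa using neg_mem_Nvn (hin v)
  · intro v i j h1 h2 h3 h4 hij
    rw [g1 v i h1 h2, g1 v j h3 h4] at hij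
    exact hinj v i j h1 h2 h3 h4 hij
  · intro v i h1 h2
    rcases h1.lt_or_eq with h3 | rfl
    · rcases (show i + 1 ≤ n v by omega).lt_or_eq with h4 | h4
      · rw [g1 v _ (by omega) h4, g1 v _ (by omega) (by omega)]
        intro h5
        have := hinj v _ _ (by omega) (by omega) (by omega) h4 h5
        omega
      · rw [h4, g3, g1 v _ (by omega) (by omega)]
        intro h5
        exact hport v _ (hout v) (h5 ▸ hfS v _ (by omega) (by omega))
    · rw [show (0 : ℤ) - 1 = -1 from rfl, g2]
      rcases (show (0 : ℤ) + 1 ≤ n v by omega).lt_or_eq with h4 | h4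
      · rw [g1 v _ (by omega) h4]
        intro h5
        exact hport v _ (hin v) (h5 ▸ hfS v _ (by omega) h4)
      · rw [h4, g3, ← hfn' v 0 h4, hf0]
        exact fun h5 => hne v (add_left_cancel h5)
  · intro v
    rw [g2, g1 v 0 le_rfl (hn v), hf0]
  · intro v
    have := hn v
    rw [g3, g1 v _ (by omega) (by omega), hfn]
  · intro v
    obtain ⟨i, h1, h2, h3⟩ := (hmem v 0).1 (h0 v)
    exact ⟨i, h1, h2, by rw [g1 v i h1 h2, h3]⟩
  · intro v v' h
    rw [g3, g1 v' 0 le_rfl (hn v'), hf0, port_add (hout v), h, neg_neg]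
  · intro v p
    rw [hmem]
    constructor
    · rintro ⟨i, h1, h2, h3⟩
      exact ⟨i, h1, h2, by rw [← h3]; exact g1 v i h1 h2⟩
    · rintro ⟨i, h1, h2, h3⟩
      exact ⟨i, h1, h2, by rw [← h3]; exact (g1 v i h1 h2).symm⟩

lemma finite_Nlin (n : ℤ) : (Nlin n).Finite := by
  refine ((Set.finite_Icc (-n) n).prod (Set.finite_singleton (0 : ℤ))).subset ?_
  rintro ⟨a, b⟩ ⟨h1, -, h3⟩
  exact ⟨abs_le.1 h3, h1⟩

section Variant

variable {X : Type} {n : ℤ} {T : Set (Tile X (Nlin n))} {M : ℕ}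

/-- The data of a block: a tile, the column modulo `M`, the codes of the virtual blocks it has
an excursion to, one for each residue, the sides it uses, and the labels telling whether these
sides come after the distinguished block. -/
@[ext] structure Variant (T : Set (Tile X (Nlin n))) (M : ℕ) where
  tile : T
  res : ZMod M
  code : ZMod M → Tile X (Nlin n)
  inS : {w : Pos // w ∈ Nvn}
  outS : {w : Pos // w ∈ Nvn}
  inL : Bool
  outL : Bool
  ne : inS ≠ outS
  mono : inL = true → outL = true
  code_res : code res = tile
  code_eq : ∀ k hw hw', code k ⟨(((res - k).val : ℤ), 0), hw⟩ =
    tile.1 ⟨-(((res - k).val : ℤ), 0), hw'⟩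

instance [Finite X] [NeZero M] : Finite (Variant T M) := by
  have : Finite {w : Pos // w ∈ Nlin n} := (finite_Nlin n).to_subtype
  have : Finite {w : Pos // w ∈ Nvn} := (show Nvn.Finite by simp [Nvn]).to_subtype
  have : Finite (ZMod M) := Finite.of_fintype _
  refine Finite.of_injective (fun v : Variant T M =>
    (v.tile, v.res, v.code, v.inS, v.outS, v.inL, v.outL)) fun v v' h => ?_
  simp only [Prod.mk.injEq] at h
  obtain ⟨h1, h2, h3, h4, h5, h6, h7⟩ := h
  exact Variant.ext h1 h2 h3 h4 h5 h6 h7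

namespace Variant

/-- The distance to the virtual block of residue `k`. -/
def off (v : Variant T M) (k : ZMod M) : ℤ := (v.res - k).val

lemma off_nonneg (v : Variant T M) (k : ZMod M) : 0 ≤ v.off k := Int.natCast_nonneg _

lemma off_lt [NeZero M] (v : Variant T M) (k : ZMod M) : v.off k < M := by
  exact Int.ofNat_lt.2 (ZMod.val_lt _)

lemma off_cast [NeZero M] (v : Variant T M) (k : ZMod M) : (v.off k : ZMod M) = v.res - k := by
  simp [off]

/-- The layers of the walls, two for each residue. -/
def layerOff (v : Variant T M) (β : ℕ) : ℤ := v.off (β / 2 : ℕ)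

/-- The numbers written in the layers, increasing with the code in even layers and decreasing
with it in odd layers. -/
def layerNum (num : Tile X (Nlin n) → ℤ) (K : ℤ) (v : Variant T M) (β : ℕ) : ℤ :=
  if β % 2 = 0 then num (v.code (β / 2 : ℕ)) else K - 1 - num (v.code (β / 2 : ℕ))

lemma exists_num [Finite X] : ∃ num : Tile X (Nlin n) → ℤ, Function.Injective num ∧
    ∀ t, 0 ≤ num t ∧ num t < Nat.card (Tile X (Nlin n)) := by
  have : Finite {w : Pos // w ∈ Nlin n} := (finite_Nlin n).to_subtype
  refine ⟨fun t => (Finite.equivFin _ t : ℕ), fun t t' h => ?_, fun t => ⟨Int.natCast_nonneg _, ?_⟩⟩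
  · exact (Finite.equivFin _).injective (Fin.ext (Int.ofNat_inj.1 h))
  · exact Int.ofNat_lt.2 (Finite.equivFin (Tile X (Nlin n)) t).2

/-- The blocks of the variants meet exactly when their codes disagree. -/
structure IsSystem (B : Blocks (Variant T M) (ZMod M × Bool)) : Prop where
  inSide : ∀ v, B.inSide v = v.inS
  outSide : ∀ v, B.outSide v = v.outS
  inC : ∀ v, B.inC v = (v.res, v.inL)
  outC : ∀ v, B.outC v = (v.res + (v.outS.1.1 : ZMod M), v.outL)
  row : ∀ v v' u u', u.2 ≠ u'.2 → ∀ i i', 0 ≤ i → i < B.len v → 0 ≤ i' → i' < B.len v' →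
    sc B.s u + B.pth v i ≠ sc B.s u' + B.pth v' i'
  free : ∀ v v' u u', u.2 = u'.2 → u.1 < u'.1 → v'.res = v.res + ((u'.1 - u.1 : ℤ) : ZMod M) →
    (∀ k, u'.1 - u.1 = v'.off k - v.off k → v.code k = v'.code k) →
    ∀ i i', 0 ≤ i → i < B.len v → 0 ≤ i' → i' < B.len v' →
    sc B.s u + B.pth v i ≠ sc B.s u' + B.pth v' i'
  collide : ∀ v v' u u', u.2 = u'.2 → u.1 < u'.1 → v'.off v.res = u'.1 - u.1 →
    v.code v.res ≠ v'.code v.res → ∃ i i', 0 ≤ i ∧ i < B.len v ∧ 0 ≤ i' ∧ i' < B.len v' ∧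
    sc B.s u + B.pth v i = sc B.s u' + B.pth v' i'

lemma exists_isSystem [Finite X] [NeZero M] : ∃ B : Blocks (Variant T M) (ZMod M × Bool),
    IsSystem B := by
  obtain ⟨num, hinj, hnum⟩ := exists_num (X := X) (n := n)
  set K := Nat.card (Tile X (Nlin n)) with hK
  have hM : 0 < M := NeZero.pos M
  set N := 2 * M + K with hN
  obtain ⟨Y, hY⟩ : ∃ Y, 4 * M * N = Y + 1 :=
    ⟨4 * M * N - 1, by have : 0 < 4 * M * N := by positivity
                       omega⟩
  set s : ℤ := Y + 3 with hsdef
  have hs : 2 * (M : ℤ) * K + 2 ≤ s := by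
    have h1 : 2 * M * K ≤ 4 * M * N := by
      rw [hN]; nlinarith [Nat.zero_le (M * K), Nat.zero_le (M * M)]
    have h2 : 2 * (M : ℤ) * K ≤ Y + 1 := by exact_mod_cast h1.trans hY.le
    omega
  have hs1 : 1 ≤ s := by omega
  have he : ∀ (v : Variant T M) β, 0 ≤ v.layerOff β := fun v β => v.off_nonneg _
  have heM : ∀ (v : Variant T M) β, v.layerOff β < M := fun v β => v.off_lt _
  have hc0 : ∀ (v : Variant T M) β, 0 ≤ v.layerNum num K β := fun v β => by
    have := hnum (v.code (β / 2 : ℕ))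
    unfold layerNum
    split_ifs <;> omega
  have hc : ∀ (v : Variant T M) β, v.layerNum num K β < K := fun v β => by
    have := hnum (v.code (β / 2 : ℕ))
    unfold layerNum
    split_ifs <;> omega
  let q : Variant T M → ℤ → ℕ → ℤ := fun v b => wallCol s M K v.layerOff (v.layerNum num K) b
  have q0 : ∀ v b, 0 ≤ b → q v b 0 = b := fun v b hb => by
    simpa using wallCol_mul (s := s) (M := M) (K := K) (c := v.layerNum num K) (he v) hb 0
  have qY : ∀ v b, 0 ≤ b → q v b (Y + 1) = b := fun v b hb => by
    rw [← hY]
    exact wallCol_mul (he v) hb _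
  choose S hS hS0 hSr using fun v : Variant T M =>
    exists_route_ports (q v 0) (q v 1) Y (q0 v 0 le_rfl) (qY v 0 le_rfl) (q0 v 1 zero_le_one)
      (qY v 1 zero_le_one) (fun p hp => wall_disjoint_wall hM hs (he v) (heM v) (hc0 v) (hc v) hp)
      v.inS v.outS v.inS.2 v.outS.2 (fun h => v.ne (Subtype.ext h))
  obtain ⟨B, hBs, hin, hout, hinC, houtC, hmem⟩ := exists_blocks hs1
    (fun v : Variant T M => v.inS.1) (fun v => v.outS.1) (fun v => (v.res, v.inL))
    (fun v => (v.res + (v.outS.1.1 : ZMod M), v.outL)) S (fun v => v.inS.2) (fun v => v.outS.2)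
    (fun v h => v.ne (Subtype.ext h)) hS
    (fun v => hS0 v ⟨0, by omega, by simp [q0 v 0 le_rfl, segment]⟩)
    (fun v d hd h => by
      have := port_add_notMem_blockRegion (q₀ := q v 0) (q₁ := q v 1) (Y := Y + 1) hd
      rw [show ((Y + 1 : ℕ) : ℤ) + 2 = s by push_cast; ring] at this
      exact this (hSr v h))
  have hreg : ∀ v i, 0 ≤ i → i < B.len v → B.pth v i ∈ blockRegion (q v 0) (q v 1) (Y + 1) :=
    fun v i h h' => hSr v ((hmem v _).2 ⟨i, h, h', rfl⟩)
  have hsc : ∀ u u' p p' : Pos, u.2 = u'.2 →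
      (sc s u + p = sc s u' + p' ↔ p = p' + (s * (u'.1 - u.1), 0)) := by
    intro u u' p p' h
    simp only [sc, Prod.ext_iff, Prod.fst_add, Prod.snd_add, h, mul_sub]
    constructor <;> rintro ⟨h1, h2⟩ <;> constructor <;> omega
  refine ⟨B, fun v => by rw [hin], fun v => by rw [hout], fun v => by rw [hinC],
    fun v => by rw [houtC], ?_, ?_, ?_⟩
  · intro v v' u u' hu i i' h1 h2 h3 h4 h
    have r1 := blockRegion_snd (hreg v i h1 h2)
    have r2 := blockRegion_snd (hreg v' i' h3 h4)
    have h5 := congrArg Prod.snd h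
    rw [hBs] at h5
    simp only [sc, Prod.snd_add] at h5
    push_cast at r1 r2
    rcases lt_or_gt_of_ne hu with h6 | h6
    · have : s * (u.2 + 1) ≤ s * u'.2 := mul_le_mul_of_nonneg_left h6 (by omega)
      rw [mul_add] at this
      omega
    · have : s * (u'.2 + 1) ≤ s * u.2 := mul_le_mul_of_nonneg_left h6 (by omega)
      rw [mul_add] at this
      omega
  · intro v v' u u' hu hlt hres hcode i i' h1 h2 h3 h4
    rw [hBs, Ne, hsc _ _ _ _ hu]
    refine blockRegion_ne_add (Y := Y + 1) (by push_cast; ring) hM hs (he v) (heM v) (hc v)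
      (he v') (hc0 v') ((hc0 v 0).trans_lt (hc v 0)) (by omega) (fun β => ?_) (hreg v i h1 h2)
      (hreg v' i' h3 h4)
    have a1 := he v β
    have a2 := heM v β
    have a3 := he v' β
    have a4 := heM v' β
    have hdvd : (M : ℤ) ∣ (u'.1 - u.1) - v'.layerOff β + v.layerOff β := by
      rw [← ZMod.intCast_zmod_eq_zero_iff_dvd]
      rw [Int.cast_add, Int.cast_sub, layerOff, layerOff, off_cast, off_cast, hres]
      ring
    obtain ⟨k, hk⟩ := hdvd
    rcases lt_trichotomy k 0 with h | rfl | h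
    · have : (M : ℤ) * k ≤ M * (-1) := mul_le_mul_of_nonneg_left (by omega) (by omega)
      omega
    · refine Or.inl ⟨by omega, ?_⟩
      have := hcode (β / 2 : ℕ) (by simp only [layerOff] at hk; omega)
      simp only [layerNum, this]
    · have : (M : ℤ) * 1 ≤ M * k := mul_le_mul_of_nonneg_left (by omega) (by omega)
      exact Or.inr (by omega)
  · intro v v' u u' hu hlt hoff hcode
    have key : ∀ β < N, ((β / 2 : ℕ) : ZMod M) = v.res →
        v'.layerNum num K β < v.layerNum num K β → ∃ i i', 0 ≤ i ∧ i < B.len v ∧ 0 ≤ i' ∧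
        i' < B.len v' ∧ sc B.s u + B.pth v i = sc B.s u' + B.pth v' i' := by
      intro β hβ hk hcc
      have ho : v'.layerOff β = u'.1 - u.1 := by rw [layerOff, hk, hoff]
      obtain ⟨p, hp, p', hp', hpp⟩ := exists_mem_wall_add (e := v.layerOff)
        (c := v.layerNum num K) (e' := v'.layerOff) (c' := v'.layerNum num K) hβ hM hs
        (by simp [layerOff, hk, off]) (he v) (hc v β) (he v') (by omega) (heM v' β) hcc
        (hc0 v' β)
      rw [hY] at hp hp'
      obtain ⟨i, h1, h2, rfl⟩ := (hmem v _).1 (hS0 v hp)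
      obtain ⟨i', h1', h2', rfl⟩ := (hmem v' _).1 (hS0 v' hp')
      exact ⟨i, i', h1, h2, h1', h2', by rw [hBs, hsc _ _ _ _ hu, hpp, ho]⟩
    have hval := ZMod.val_lt v.res
    have d1 : 2 * v.res.val / 2 = v.res.val := by omega
    have d2 : (2 * v.res.val + 1) / 2 = v.res.val := by omega
    rcases lt_or_gt_of_ne (fun h => hcode (hinj h)) with h | h
    · refine key (2 * v.res.val + 1) (by omega) (by rw [d2]; simp) ?_
      simp only [layerNum, d2, ZMod.natCast_val, ZMod.cast_id', id_eq]
      rw [if_neg (by omega), if_neg (by omega)]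
      omega
    · refine key (2 * v.res.val) (by omega) (by rw [d1]; simp) ?_
      simp only [layerNum, d1, ZMod.natCast_val, ZMod.cast_id', id_eq]
      rw [if_pos (by omega), if_pos (by omega)]
      omega

end Variant
end Variant

namespace Variant

variable {X : Type} {n : ℤ} {T : Set (Tile X (Nlin n))} {M : ℕ}
  {B : Blocks (Variant T M) (ZMod M × Bool)} {J : Set ℤ} {Q : ℤ → Pos}
  {m : Pos → Option (Variant T M)}

/-- The tiles represented by a partial map to variants. -/
def tiling (m : Pos → Option (Variant T M)) (u : Pos) : Option (Tile X (Nlin n)) :=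
  (m u).map fun v => v.tile.1

lemma tiling_eq_some {u : Pos} {t : Tile X (Nlin n)} :
    tiling m u = some t ↔ ∃ v, m u = some v ∧ v.tile.1 = t := by
  simp [tiling]

lemma tdom_tiling : tdom (tiling m) = tdom m := by
  ext u
  simp [tdom, tiling]

namespace IsSystem

lemma link (hB : IsSystem B) (h : B.IsBlockSeq J Q m) {j : ℤ} (hj : j ∈ J) (hj' : j + 1 ∈ J)
    {v v' : Variant T M} (hv : m (Q j) = some v) (hv' : m (Q (j + 1)) = some v') :
    v.outS.1 = -v'.inS.1 ∧ v'.res = v.res + (v.outS.1.1 : ZMod M) ∧ v.outL = v'.inL ∧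
      Q (j + 1) = Q j + v.outS.1 := by
  obtain ⟨⟨h1, h2⟩, h3⟩ := h.link j hj hj' v v' hv hv'
  rw [hB.outSide] at h1 h3
  rw [hB.inSide] at h1
  rw [hB.outC, hB.inC, Prod.mk.injEq] at h2
  exact ⟨h1, h2.1.symm, h2.2, h3⟩

lemma res_sub_aux (hB : IsSystem B) (h : B.IsBlockSeq J Q m) (k : ℕ) {j : ℤ} (hj : j ∈ J)
    (hj' : j + k ∈ J) {v v' : Variant T M} (hv : m (Q j) = some v)
    (hv' : m (Q (j + k)) = some v') :
    v'.res - ((Q (j + k)).1 : ZMod M) = v.res - ((Q j).1 : ZMod M) := by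
  induction k generalizing v' with
  | zero =>
    simp only [Nat.cast_zero, add_zero] at hv' ⊢
    rw [hv] at hv'
    cases hv'
    rfl
  | succ k ih =>
    push_cast at hj' hv' ⊢
    rw [← add_assoc] at hj' hv' ⊢
    have hm : j + k ∈ J := h.interval _ _ _ hj hj' (by omega) (by omega)
    obtain ⟨w, hw⟩ := Option.ne_none_iff_exists'.1 (h.apply_ne_none hm)
    obtain ⟨-, h1, -, h2⟩ := hB.link h hm hj' hw hv'
    rw [← ih hm hw, h1, h2]
    simp only [Prod.fst_add]
    push_cast
    ring

lemma res_sub (hB : IsSystem B) (h : B.IsBlockSeq J Q m) {u u' : Pos} {v v' : Variant T M}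
    (hv : m u = some v) (hv' : m u' = some v') :
    v'.res = v.res + ((u'.1 - u.1 : ℤ) : ZMod M) := by
  obtain ⟨j, hj, rfl⟩ := h.exists_eq hv
  obtain ⟨j', hj', rfl⟩ := h.exists_eq hv'
  push_cast
  rcases le_total j j' with hle | hle
  · obtain ⟨k, hk⟩ := Int.le.dest hle
    subst hk
    linear_combination hB.res_sub_aux h k hj hj' hv hv'
  · obtain ⟨k, hk⟩ := Int.le.dest hle
    subst hk
    linear_combination -hB.res_sub_aux h k hj' hj hv' hv

lemma glue_eq (hB : IsSystem B) (hn : n < M) (h : B.IsBlockSeq J Q m) {u w : Pos}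
    {v v' : Variant T M} (hv : m u = some v) (hv' : m (u + w) = some v') (hw : w ∈ Nlin n)
    (hw' : -w ∈ Nlin n) (hpos : 0 < w.1) : v.tile.1 ⟨w, hw⟩ = v'.tile.1 ⟨-w, hw'⟩ := by
  have : NeZero M := ⟨by
    have := abs_nonneg w.1
    have := hw.2.2
    omega⟩
  have hle : w.1 ≤ n := (le_abs_self _).trans hw.2.2
  have hres := hB.res_sub h hv hv'
  have hoff : v'.off v.res = w.1 := by
    simp only [off, hres, Prod.fst_add, add_sub_cancel_left]
    rw [ZMod.val_intCast]
    exact Int.emod_eq_of_lt hpos.le (by omega)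
  have hcode : v.code v.res = v'.code v.res := by
    by_contra hne
    obtain ⟨i, i', h1, h2, h3, h4, h5⟩ := hB.collide v v' u (u + w) (by simp [hw.1])
      (by simpa using hpos) (by simpa using hoff) hne
    exact h.disjoint u (u + w) v v' (fun h => by simp [left_eq_add.1 h] at hpos) hv hv'
      i i' h1 h2 h3 h4 h5
  have hwe : w = (((v'.res - v.res).val : ℤ), 0) := Prod.ext hoff.symm hw.1
  have := v'.code_eq v.res (hwe ▸ hw) (hwe ▸ hw')
  rw [← hcode, v.code_res] at this
  convert this

lemma isZipper (hB : IsSystem B) (hn : n < M) (h : B.IsBlockSeq J Q m) :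
    IsZipper T J Q (tiling m) := by
  have hT : ∀ p t, tiling m p = some t → t ∈ T := by
    intro p t ht
    obtain ⟨v, -, rfl⟩ := tiling_eq_some.1 ht
    exact v.tile.2
  refine ⟨⟨⟨h.interval, fun j hj hj' => ?_⟩, by rw [tdom_tiling, h.dom], hT⟩, h.inj, hT, ?_⟩
  · obtain ⟨v, hv⟩ := Option.ne_none_iff_exists'.1 (h.apply_ne_none hj)
    obtain ⟨v', hv'⟩ := Option.ne_none_iff_exists'.1 (h.apply_ne_none hj')
    rw [(hB.link h hj hj' hv hv').2.2.2, add_sub_cancel_left]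
    exact v.outS.2
  · intro p t ht w t' ht' hw hw'
    obtain ⟨v, hv, rfl⟩ := tiling_eq_some.1 ht
    obtain ⟨v', hv', rfl⟩ := tiling_eq_some.1 ht'
    rcases lt_or_gt_of_ne (abs_pos.1 hw.2.1) with hneg | hpos
    · have := hB.glue_eq hn h (w := -w) hv' (by simpa using hv) hw' (by simpa using hw)
        (by simpa using hneg)
      rw [this]
      simp only [neg_neg]
    · exact hB.glue_eq hn h hv hv' hw hw' hpos

end IsSystem
end Variant

namespace Variant

variable {X : Type} {n : ℤ} {T : Set (Tile X (Nlin n))} {M : ℕ}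
  {B : Blocks (Variant T M) (ZMod M × Bool)} {J J' : Set ℤ} {Q Q' : ℤ → Pos}
  {m : Pos → Option (Variant T M)}

/-- The variant in the block `u` is the distinguished one. -/
def IsBase (m : Pos → Option (Variant T M)) (u : Pos) : Prop :=
  ∃ v, m u = some v ∧ v.inL = false ∧ v.outL = true

namespace IsSystem

lemma inL_of_base (hB : IsSystem B) (h : B.IsBlockSeq J Q m) {i : ℤ} (hi : i ∈ J)
    (hb : IsBase m (Q i)) (k : ℕ) (hk : i + k + 1 ∈ J) {v : Variant T M}
    (hv : m (Q (i + k + 1)) = some v) : v.inL = true := by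
  induction k generalizing v with
  | zero =>
    simp only [Nat.cast_zero, add_zero] at hk hv
    obtain ⟨w, hw, -, h1⟩ := hb
    rw [← (hB.link h hi hk hw hv).2.2.1, h1]
  | succ k ih =>
    push_cast at hk hv
    rw [← add_assoc] at hk hv
    have hm : i + k + 1 ∈ J := h.interval _ _ _ hi hk (by omega) (by omega)
    obtain ⟨w, hw⟩ := Option.ne_none_iff_exists'.1 (h.apply_ne_none hm)
    rw [← (hB.link h hm hk hw hv).2.2.1]
    exact w.mono (ih hm hw)

lemma outL_of_base (hB : IsSystem B) (h : B.IsBlockSeq J Q m) {i : ℤ} (hi : i ∈ J)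
    (hb : IsBase m (Q i)) (k : ℕ) (hk : i - k - 1 ∈ J) {v : Variant T M}
    (hv : m (Q (i - k - 1)) = some v) : v.outL = false := by
  induction k generalizing v with
  | zero =>
    simp only [Nat.cast_zero, sub_zero] at hk hv
    obtain ⟨w, hw, h1, -⟩ := hb
    rw [(hB.link h hk (by simpa using hi) hv (by simpa using hw)).2.2.1, h1]
  | succ k ih =>
    push_cast at hk hv
    rw [← sub_sub] at hk hv
    have hm : i - k - 1 ∈ J := h.interval _ _ _ hk hi (by omega) (by omega)
    obtain ⟨w, hw⟩ := Option.ne_none_iff_exists'.1 (h.apply_ne_none hm)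
    rw [(hB.link h hk (by simpa using hm) hv (by simpa using hw)).2.2.1]
    exact Bool.eq_false_iff.2 fun h1 => by
      have := w.mono h1
      rw [ih hm hw] at this
      exact Bool.false_ne_true this

lemma lt_of_inL (hB : IsSystem B) (h : B.IsBlockSeq J Q m) {i j : ℤ} (hi : i ∈ J) (hj : j ∈ J)
    (hb : IsBase m (Q i)) {v : Variant T M} (hv : m (Q j) = some v) (hl : v.inL = true) :
    i < j := by
  by_contra! hle
  rcases hle.lt_or_eq with hlt | rfl
  · obtain ⟨k, hk⟩ := Int.le.dest (show j + 1 ≤ i by omega)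
    obtain rfl : j = i - k - 1 := by omega
    have := v.mono hl
    rw [hB.outL_of_base h hi hb k hj hv] at this
    exact Bool.false_ne_true this
  · obtain ⟨w, hw, h1, -⟩ := hb
    rw [hw, Option.some.injEq] at hv
    rw [← hv, h1] at hl
    exact Bool.false_ne_true hl

lemma lt_of_outL (hB : IsSystem B) (h : B.IsBlockSeq J Q m) {i j : ℤ} (hi : i ∈ J) (hj : j ∈ J)
    (hb : IsBase m (Q i)) {v : Variant T M} (hv : m (Q j) = some v) (hl : v.outL = false) :
    j < i := by
  by_contra! hle
  rcases hle.lt_or_eq with hlt | rfl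
  · obtain ⟨k, hk⟩ := Int.le.dest (show i + 1 ≤ j by omega)
    obtain rfl : j = i + k + 1 := by omega
    rw [v.mono (hB.inL_of_base h hi hb k hj hv)] at hl
    exact Bool.false_ne_true hl.symm
  · obtain ⟨w, hw, -, h1⟩ := hb
    rw [hw, Option.some.injEq] at hv
    rw [← hv, h1] at hl
    exact Bool.false_ne_true hl.symm

lemma exists_eq_of_add (hB : IsSystem B) (h : B.IsBlockSeq J Q m) (h' : B.IsBlockSeq J' Q' m)
    {i i' : ℤ} (hi : i ∈ J) (hi' : i' ∈ J') (hb : IsBase m (Q i)) (heq : Q' i' = Q i) (k : ℕ)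
    (hk : i + k ∈ J) : i' + k ∈ J' ∧ Q' (i' + k) = Q (i + k) := by
  induction k with
  | zero => simpa [hi'] using heq
  | succ k ih =>
    push_cast at hk ⊢
    rw [← add_assoc] at hk ⊢
    rw [← add_assoc]
    have hm : i + k ∈ J := h.interval _ _ _ hi hk (by omega) (by omega)
    obtain ⟨hm', hQ⟩ := ih hm
    obtain ⟨w, hw⟩ := Option.ne_none_iff_exists'.1 (h.apply_ne_none hm)
    obtain ⟨v, hv⟩ := Option.ne_none_iff_exists'.1 (h.apply_ne_none hk)
    have hin := hB.inL_of_base h hi hb k hk hv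
    obtain ⟨h1, -, -, h2⟩ := hB.link h hm hk hw hv
    obtain ⟨j, hj, hjQ⟩ := h'.exists_eq hv
    have hlt := hB.lt_of_inL h' hi' hj (heq ▸ hb) (hjQ ▸ hv) hin
    have hj1 : j - 1 ∈ J' := h'.interval _ _ _ hi' hj (by omega) (by omega)
    obtain ⟨x, hx⟩ := Option.ne_none_iff_exists'.1 (h'.apply_ne_none hj1)
    obtain ⟨h3, -, -, h4⟩ := hB.link h' hj1 (by simpa using hj) hx (by simpa [hjQ] using hv)
    have h5 : Q' (j - 1) = Q' (i' + k) := by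
      rw [hQ]
      rw [sub_add_cancel, hjQ, h2, h3, h1] at h4
      exact (add_right_cancel h4).symm
    have h6 := h'.inj _ hj1 _ hm' h5
    obtain rfl : j = i' + k + 1 := by omega
    exact ⟨hj, hjQ⟩

lemma exists_eq_of_sub (hB : IsSystem B) (h : B.IsBlockSeq J Q m) (h' : B.IsBlockSeq J' Q' m)
    {i i' : ℤ} (hi : i ∈ J) (hi' : i' ∈ J') (hb : IsBase m (Q i)) (heq : Q' i' = Q i) (k : ℕ)
    (hk : i - k ∈ J) : i' - k ∈ J' ∧ Q' (i' - k) = Q (i - k) := by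
  induction k with
  | zero => simpa [hi'] using heq
  | succ k ih =>
    push_cast at hk ⊢
    rw [← sub_sub] at hk ⊢
    rw [← sub_sub]
    have hm : i - k ∈ J := h.interval _ _ _ hk hi (by omega) (by omega)
    obtain ⟨hm', hQ⟩ := ih hm
    obtain ⟨w, hw⟩ := Option.ne_none_iff_exists'.1 (h.apply_ne_none hm)
    obtain ⟨v, hv⟩ := Option.ne_none_iff_exists'.1 (h.apply_ne_none hk)
    have hout := hB.outL_of_base h hi hb k hk hv
    obtain ⟨-, -, -, h2⟩ := hB.link h hk (by simpa using hm) hv (by simpa using hw)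
    obtain ⟨j, hj, hjQ⟩ := h'.exists_eq hv
    have hlt := hB.lt_of_outL h' hi' hj (heq ▸ hb) (hjQ ▸ hv) hout
    have hj1 : j + 1 ∈ J' := h'.interval _ _ _ hj hi' (by omega) (by omega)
    obtain ⟨x, hx⟩ := Option.ne_none_iff_exists'.1 (h'.apply_ne_none hj1)
    obtain ⟨-, -, -, h4⟩ := hB.link h' hj hj1 (hjQ ▸ hv) hx
    have h5 : Q' (j + 1) = Q' (i' - k) := by
      rw [hQ, h4, hjQ, ← h2, sub_add_cancel]
    have h6 := h'.inj _ hj1 _ hm' h5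
    obtain rfl : j = i' - k - 1 := by omega
    exact ⟨hj, hjQ⟩

/-- The path of a sequence of blocks is determined by the distinguished block. -/
lemma exists_shift (hB : IsSystem B) (h : B.IsBlockSeq J Q m) (h' : B.IsBlockSeq J' Q' m)
    {i : ℤ} (hi : i ∈ J) (hb : IsBase m (Q i)) :
    ∃ d : ℤ, (∀ j, j ∈ J ↔ j + d ∈ J') ∧ ∀ j ∈ J, Q' (j + d) = Q j := by
  obtain ⟨v, hv, -⟩ := id hb
  obtain ⟨i', hi', heq⟩ := h'.exists_eq hv
  have key : ∀ {J J' : Set ℤ} {Q Q' : ℤ → Pos} {i i' : ℤ}, B.IsBlockSeq J Q m →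
      B.IsBlockSeq J' Q' m → i ∈ J → i' ∈ J' → IsBase m (Q i) → Q' i' = Q i → ∀ j ∈ J,
      j + (i' - i) ∈ J' ∧ Q' (j + (i' - i)) = Q j := by
    intro J J' Q Q' i i' h h' hi hi' hb heq j hj
    rcases le_total i j with hle | hle
    · obtain ⟨k, rfl⟩ := Int.le.dest hle
      rw [show i + k + (i' - i) = i' + k by ring]
      exact hB.exists_eq_of_add h h' hi hi' hb heq k hj
    · obtain ⟨k, hk⟩ := Int.le.dest hle
      obtain rfl : j = i - k := by omega
      rw [show i - k + (i' - i) = i' - k by ring]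
      exact hB.exists_eq_of_sub h h' hi hi' hb heq k hj
  refine ⟨i' - i, fun j => ⟨fun hj => (key h h' hi hi' hb heq j hj).1, fun hj => ?_⟩,
    fun j hj => (key h h' hi hi' hb heq j hj).2⟩
  have := (key h' h hi' hi (heq ▸ hb) heq.symm _ hj).1
  rwa [show j + (i' - i) + (i - i') = j by ring] at this

end IsSystem
end Variant

namespace Variant

variable {X : Type} {n : ℤ} {T : Set (Tile X (Nlin n))} {M : ℕ}

lemma neg_mem_Nlin {w : Pos} (hw : w ∈ Nlin n) : -w ∈ Nlin n := by
  obtain ⟨h1, h2, h3⟩ := hw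
  exact ⟨by simp [h1], by simpa using h2, by simpa using h3⟩

/-- The tile at `u`, or, outside of the domain of `r`, a tile whose glues match those of the
neighboring tiles. -/
noncomputable def codeAt (t₀ : Tile X (Nlin n)) (r : Pos → Option (Tile X (Nlin n))) (u : Pos) :
    Tile X (Nlin n) := fun w =>
  match r u, r (u + w) with
  | some t, _ => t w
  | none, some t => t ⟨-w, neg_mem_Nlin w.2⟩
  | none, none => t₀ w

lemma codeAt_of_eq {t₀ t : Tile X (Nlin n)} {r : Pos → Option (Tile X (Nlin n))} {u : Pos}
    (h : r u = some t) : codeAt t₀ r u = t := by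
  funext w
  simp [codeAt, h]

lemma codeAt_apply {t₀ t : Tile X (Nlin n)} {r : Pos → Option (Tile X (Nlin n))} {u w : Pos}
    (hr : IsTiling T r) (h : r (u + w) = some t) (hw : w ∈ Nlin n) (hw' : -w ∈ Nlin n) :
    codeAt t₀ r u ⟨w, hw⟩ = t ⟨-w, hw'⟩ := by
  rcases hu : r u with _ | t'
  · simp [codeAt, h, hu]
  · rw [codeAt_of_eq hu]
    exact hr.2 u t' hu w t h hw hw'

lemma exists_sides {I : Set ℤ} {P : ℤ → Pos} (hP : IsPath I P)
    (hinj : ∀ i ∈ I, ∀ j ∈ I, P i = P j → i = j) (i : ℤ) (hi : i ∈ I) :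
    ∃ a b : {w : Pos // w ∈ Nvn}, a ≠ b ∧ (i - 1 ∈ I → a.1 = P (i - 1) - P i) ∧
      (i + 1 ∈ I → b.1 = P (i + 1) - P i) := by
  have hb : i + 1 ∈ I → P (i + 1) - P i ∈ Nvn := hP.2 i hi
  have ha : i - 1 ∈ I → P (i - 1) - P i ∈ Nvn := fun h => by
    have := neg_mem_Nvn (hP.2 (i - 1) h (by simpa using hi))
    simpa using this
  obtain ⟨a₀, ha₀, h1, -⟩ := exists_mem_Nvn_ne (P (i + 1) - P i) (P (i + 1) - P i)
  obtain ⟨b₀, hb₀, h2, h3⟩ := exists_mem_Nvn_ne (P (i - 1) - P i) a₀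
  by_cases hia : i - 1 ∈ I <;> by_cases hib : i + 1 ∈ I
  · refine ⟨⟨_, ha hia⟩, ⟨_, hb hib⟩, fun h => ?_, fun _ => rfl, fun _ => rfl⟩
    have := hinj _ hia _ hib (sub_left_inj.1 (congrArg Subtype.val h))
    omega
  · exact ⟨⟨_, ha hia⟩, ⟨_, hb₀⟩, fun h => h2 (congrArg Subtype.val h).symm, fun _ => rfl,
      fun h => absurd h hib⟩
  · exact ⟨⟨_, ha₀⟩, ⟨_, hb hib⟩, fun h => h1 (congrArg Subtype.val h),
      fun h => absurd h hia, fun _ => rfl⟩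
  · exact ⟨⟨_, ha₀⟩, ⟨_, hb₀⟩, fun h => h3 (congrArg Subtype.val h).symm,
      fun h => absurd h hia, fun h => absurd h hib⟩

lemma exists_variant [NeZero M] {I : Set ℤ} {P : ℤ → Pos} {r : Pos → Option (Tile X (Nlin n))}
    (hz : IsZipper T I P r) (t₀ : Tile X (Nlin n)) (i₀ i : ℤ) (hi : i ∈ I) :
    ∃ v : Variant T M, r (P i) = some v.tile.1 ∧ v.res = ((P i).1 : ZMod M) ∧
      (∀ k, v.code k = codeAt t₀ r ((P i).1 - v.off k, (P i).2)) ∧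
      (i - 1 ∈ I → v.inS.1 = P (i - 1) - P i) ∧ (i + 1 ∈ I → v.outS.1 = P (i + 1) - P i) ∧
      v.inL = decide (i₀ < i) ∧ v.outL = decide (i₀ ≤ i) := by
  obtain ⟨⟨hP, hdom, hT⟩, hinj, hr⟩ := hz
  have : P i ∈ tdom r := hdom ▸ ⟨i, hi, rfl⟩
  obtain ⟨t, ht⟩ := Option.ne_none_iff_exists'.1 this
  obtain ⟨a, b, hab, ha, hb⟩ := exists_sides hP hinj i hi
  refine ⟨⟨⟨t, hT _ _ ht⟩, (P i).1,
    fun k => codeAt t₀ r ((P i).1 - ((((P i).1 : ZMod M) - k).val : ℤ), (P i).2), a, b,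
    decide (i₀ < i), decide (i₀ ≤ i), hab, fun h => ?_, ?_, fun k hw hw' => ?_⟩, ht, rfl,
    fun _ => rfl, ha, hb, rfl, rfl⟩
  · simp only [decide_eq_true_eq] at h ⊢
    exact h.le
  · exact codeAt_of_eq (by simpa using ht)
  · exact codeAt_apply hr (by simpa using ht) hw hw'

/-- Every zipper is represented by a sequence of blocks, with any given distinguished block. -/
lemma IsSystem.exists_isBlockSeq [NeZero M] {B : Blocks (Variant T M) (ZMod M × Bool)}
    (hB : IsSystem B) {I : Set ℤ} {P : ℤ → Pos} {r : Pos → Option (Tile X (Nlin n))}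
    (hz : IsZipper T I P r) {i₀ : ℤ} (hi₀ : i₀ ∈ I) :
    ∃ m, B.IsBlockSeq I P m ∧ tiling m = r ∧ IsBase m (P i₀) := by
  have h₀ : P i₀ ∈ tdom r := hz.1.2.1 ▸ ⟨i₀, hi₀, rfl⟩
  obtain ⟨t₀, -⟩ := Option.ne_none_iff_exists'.1 h₀
  have hex := exists_variant (M := M) hz t₀ i₀
  have : Nonempty (Variant T M) := ⟨(hex i₀ hi₀).choose⟩
  choose! v htile hres hcode hin hout hinL houtL using hex
  obtain ⟨⟨hP, hdom, -⟩, hinj, -⟩ := hz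
  have hm : ∀ {u w}, place I P v u = some w ↔ ∃ i ∈ I, P i = u ∧ v i = w :=
    place_eq_some hinj
  refine ⟨place I P v, ⟨hP.1, hinj, tdom_place I P v, ?_, ?_⟩, ?_, ?_⟩
  · intro j hj hj' w w' hw hw'
    obtain ⟨i, hi, hij, rfl⟩ := hm.1 hw
    obtain rfl := hinj _ hi _ hj hij
    obtain ⟨i', hi', hij', rfl⟩ := hm.1 hw'
    obtain rfl := hinj _ hi' _ hj' hij'
    have h1 := hout i hj hj'
    have h2 := hin (i + 1) hj' (by simpa using hj)
    rw [add_sub_cancel_right] at h2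
    refine ⟨⟨by rw [hB.outSide, hB.inSide, h1, h2, neg_sub], ?_⟩,
      by rw [hB.outSide, h1, add_sub_cancel]⟩
    rw [hB.outC, hB.inC, h1, hres i hj, hres _ hj', houtL i hj, hinL _ hj', Prod.mk.injEq,
      Prod.fst_sub]
    exact ⟨by push_cast; ring, by simp⟩
  · have key : ∀ i ∈ I, ∀ i' ∈ I, (P i).1 < (P i').1 → (P i).2 = (P i').2 → ∀ a a',
        0 ≤ a → a < B.len (v i) → 0 ≤ a' → a' < B.len (v i') →
        sc B.s (P i) + B.pth (v i) a ≠ sc B.s (P i') + B.pth (v i') a' := by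
      intro i hi i' hi' hlt h2
      refine hB.free _ _ _ _ h2 hlt ?_ fun k hk => ?_
      · rw [hres i hi, hres i' hi']
        push_cast
        ring
      · rw [hcode i hi, hcode i' hi', h2]
        congr 2
        omega
    intro u u' w w' hne hw hw' a a' h1 h2 h3 h4
    obtain ⟨i, hi, rfl, rfl⟩ := hm.1 hw
    obtain ⟨i', hi', rfl, rfl⟩ := hm.1 hw'
    by_cases hrow : (P i).2 = (P i').2
    · rcases lt_trichotomy (P i).1 (P i').1 with h | h | h
      · exact key i hi i' hi' h hrow a a' h1 h2 h3 h4
      · exact absurd (Prod.ext h hrow) hne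
      · exact (key i' hi' i hi h hrow.symm a' a h3 h4 h1 h2).symm
    · exact hB.row _ _ _ _ hrow a a' h1 h2 h3 h4
  · funext u
    by_cases hu : u ∈ tdom r
    · obtain ⟨i, hi, rfl⟩ := hdom ▸ hu
      rw [htile i hi]
      exact tiling_eq_some.2 ⟨_, hm.2 ⟨i, hi, rfl, rfl⟩, rfl⟩
    · have h1 : u ∉ tdom (tiling (place I P v)) := by rwa [tdom_tiling, tdom_place, ← hdom]
      rw [not_not.1 hu, not_not.1 h1]
  · exact ⟨v i₀, hm.2 ⟨i₀, hi₀, rfl, rfl⟩, by simp [hinL i₀ hi₀], by simp [houtL i₀ hi₀]⟩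

end Variant

/-- The paths `(I, P)` and `(I', P')` are equal up to a shift of the indices. -/
def SamePath (I : Set ℤ) (P : ℤ → Pos) (I' : Set ℤ) (P' : ℤ → Pos) : Prop :=
  ∃ d : ℤ, (∀ i, i ∈ I ↔ i + d ∈ I') ∧ ∀ i ∈ I, P' (i + d) = P i

lemma SamePath.refl (I : Set ℤ) (P : ℤ → Pos) : SamePath I P I P := ⟨0, by simp⟩

lemma SamePath.symm {I I' : Set ℤ} {P P' : ℤ → Pos} (h : SamePath I P I' P') :
    SamePath I' P' I P := by
  obtain ⟨d, h1, h2⟩ := h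
  have h3 : ∀ i, i ∈ I' ↔ i + -d ∈ I := fun i => by simp [h1]
  exact ⟨-d, h3, fun i hi => by simp [← h2 _ ((h3 i).1 hi)]⟩

lemma SamePath.trans {I I' I'' : Set ℤ} {P P' P'' : ℤ → Pos} (h : SamePath I P I' P')
    (h' : SamePath I' P' I'' P'') : SamePath I P I'' P'' := by
  obtain ⟨d, h1, h2⟩ := h
  obtain ⟨d', h3, h4⟩ := h'
  refine ⟨d + d', fun i => by rw [h1, h3, add_assoc], fun i hi => ?_⟩
  rw [← add_assoc, h4 _ ((h1 i).1 hi), h2 i hi]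

namespace Variant

variable {X : Type} {n : ℤ} {T : Set (Tile X (Nlin n))} {M : ℕ}
  {B : Blocks (Variant T M) (ZMod M × Bool)}

/-- The path `(I, P)` is, up to a shift, the one chosen among those followed by `m`. -/
def IsChosen (B : Blocks (Variant T M) (ZMod M × Bool)) (m : Pos → Option (Variant T M))
    (I : Set ℤ) (P : ℤ → Pos) : Prop :=
  B.IsBlockSeq I P m ∧
    ∀ h : ∃ p : Set ℤ × (ℤ → Pos), B.IsBlockSeq p.1 p.2 m, SamePath I P h.choose.1 h.choose.2

lemma exists_isChosen {m : Pos → Option (Variant T M)} {I : Set ℤ} {P : ℤ → Pos}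
    (h : B.IsBlockSeq I P m) : ∃ I P, IsChosen B m I P :=
  have h' : ∃ p : Set ℤ × (ℤ → Pos), B.IsBlockSeq p.1 p.2 m := ⟨(I, P), h⟩
  ⟨_, _, h'.choose_spec, fun _ => SamePath.refl _ _⟩

lemma IsChosen.samePath {m : Pos → Option (Variant T M)} {I I' : Set ℤ} {P P' : ℤ → Pos}
    (h : IsChosen B m I P) (h' : IsChosen B m I' P') : SamePath I P I' P' :=
  (h.2 ⟨(I, P), h.1⟩).trans (h'.2 ⟨(I, P), h.1⟩).symm

lemma IsSystem.exists_isChosen_tiling [NeZero M] (hB : IsSystem B) {I : Set ℤ} {P : ℤ → Pos}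
    {r : Pos → Option (Tile X (Nlin n))} (hz : IsZipper T I P r) :
    ∃ m, IsChosen B m I P ∧ tiling m = r := by
  rcases I.eq_empty_or_nonempty with rfl | ⟨i₀, hi₀⟩
  · have hr : ∀ u, r u = none := fun u => by
      by_contra hu
      have : u ∈ tdom r := hu
      simp [hz.1.2.1] at this
    refine ⟨fun _ => none, ⟨⟨hz.1.1.1, hz.2.1, by simp [tdom], by simp, by simp⟩, fun h => ?_⟩,
      funext fun u => by simp [tiling, hr]⟩
    have h1 := h.choose_spec.dom
    have h2 : h.choose.1 = ∅ := by
      rw [← Set.image_eq_empty, ← h1]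
      simp [tdom]
    rw [h2]
    exact ⟨0, by simp⟩
  · obtain ⟨m, hm, htile, hb⟩ := hB.exists_isBlockSeq hz hi₀
    exact ⟨m, ⟨hm, fun h => hB.exists_shift hm h.choose_spec hi₀ hb⟩, htile⟩

lemma map_rib_injective {m m' : Pos → Option (Variant T M)}
    (h : (fun u => (m u).map B.rib) = fun u => (m' u).map B.rib) : m = m' :=
  funext fun u => Option.map_injective B.rib_injective (congrFun h u)

/-- The simulation of zippers by sequences of blocks. -/
noncomputable def simulation [NeZero M] (hn : n < M) (hB : IsSystem B) :
    ZipperSimulation X B.Glue (Nlin n) T B.tiles B.s where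
  hs := B.one_le_s
  phi t := {R | ∃ v : Variant T M, v.tile = t ∧ B.rib v = R}
  phi_fin := by
    rintro t _ ⟨v, -, rfl⟩
    rw [Blocks.rib_I]
    exact ⟨Set.finite_Ico _ _, ⟨0, le_rfl, B.len_pos v⟩⟩
  phi_ref := by
    rintro t _ ⟨v, -, rfl⟩
    obtain ⟨i, h0, h1, hi⟩ := B.exists_pth_eq_zero v
    have := B.rib_r_pth h0 h1
    rw [hi] at this
    exact Option.ne_none_iff_exists'.2 ⟨_, this⟩
  phi_spec := by
    rintro t t' hne _ ⟨v, rfl, rfl⟩ _ ⟨v', rfl, rfl⟩ p q a b ha hb rfl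
    exact hne (by rw [B.eq_of_rib_r ha hb])
  chi R u := (B.copies R.r u).map B.rib
  chi_poly R := by
    obtain ⟨J, Q, h⟩ := B.exists_isBlockSeq R
    exact ⟨J, Q, h.isPolyRibbon⟩
  chi_sub := by
    intro R u S hS
    obtain ⟨v, hv, rfl⟩ := Option.map_eq_some_iff.1 hS
    refine ⟨⟨v.tile, v.tile.2, v, rfl, rfl⟩, fun p a ha => ?_⟩
    obtain ⟨i, h0, h1, rfl, rfl⟩ := B.rib_r_eq_some.1 ha
    exact Blocks.copies_eq_some.1 hv i h0 h1
  chi_max := by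
    rintro R t - _ ⟨v, -, rfl⟩ u h
    rw [Blocks.copies_eq_some.2 fun i h0 h1 => h _ _ (B.rib_r_pth h0 h1)]
    simp
  psi I P r := {ρ | ∃ m, (ρ = fun u => (m u).map B.rib) ∧ IsChosen B m I P ∧ tiling m = r}
  psi_nonempty I P r hz := by
    obtain ⟨m, hm⟩ := hB.exists_isChosen_tiling hz
    exact ⟨_, m, rfl, hm⟩
  psi_poly := by
    rintro I P r - _ ⟨m, rfl, hm, -⟩
    exact hm.1.isPolyRibbon
  psi_comp := by
    rintro I P r - _ ⟨m, rfl, -, rfl⟩ u t ht S hS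
    obtain ⟨v, hv, rfl⟩ := Option.map_eq_some_iff.1 hS
    obtain ⟨v', hv', rfl⟩ := tiling_eq_some.1 ht
    rw [hv, Option.some.injEq] at hv'
    exact ⟨v, by rw [hv'], rfl⟩
  psi_exists R := by
    obtain ⟨J, Q, h⟩ := B.exists_isBlockSeq R
    obtain ⟨I, P, h'⟩ := exists_isChosen h
    exact ⟨I, P, _, hB.isZipper hn h'.1, _, rfl, h', rfl⟩
  psi_unique := by
    rintro R I P r I' P' r' - - ⟨m, h1, h2, rfl⟩ ⟨m', h1', h2', rfl⟩
    obtain rfl : m = m' := map_rib_injective (h1.symm.trans h1')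
    exact ⟨rfl, h2.samePath h2'⟩

end Variant

/-- simulation of connected-linear-neighborhood zippers by ribbons. -/
theorem stmt6 (X : Type) [Fintype X] (n : ℤ) (hn : 1 ≤ n)
    (T : Set (Tile X (Nlin n))) (hT : T.Finite) :
    ∃ (Xμ : Type) (_ : Fintype Xμ) (Tμ : Set (Tile Xμ Nvn)) (_ : Tμ.Finite)
      (s : ℤ) (sim : ZipperSimulation X Xμ (Nlin n) T Tμ s),
      ∀ I P r, IsZipper T I P r → ∃ R : Ribbon Xμ Tμ, sim.chi R ∈ sim.psi I P r := by
  have hM : n < ((n.toNat + 1 : ℕ) : ℤ) := by omega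
  obtain ⟨B, hB⟩ := Variant.exists_isSystem (X := X) (n := n) (T := T) (M := n.toNat + 1)
  have : Finite {w : Pos // w ∈ Nvn} := (show Nvn.Finite by simp [Nvn]).to_subtype
  have : Finite (ZMod (n.toNat + 1)) := Finite.of_fintype _
  refine ⟨B.Glue, Fintype.ofFinite _, B.tiles, B.tiles_finite, B.s, Variant.simulation hM hB, ?_⟩
  intro I P r hz
  obtain ⟨m, hm, htile⟩ := hB.exists_isChosen_tiling hz
  obtain ⟨R, rfl⟩ := hm.1.exists_copies_eq
  exact ⟨R, _, rfl, hm, htile⟩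

end Paper
end

section
/- Let m,n ≥ 1 and let T be a tile system in the rectangular neighborhood N_{m,n}, with finite set of glues X. There exist a finite glue set X_μ, a tile system T_μ in neighborhood N_vN over X_μ, a scale s ≥ 1, a polyomino assignment φ of scale s from T to finite (T_μ,N_vN)-tilings, and a tiling-simulation ψ of T by T_μ; in particular every (T,N_{m,n})-tiling is simulated by some (T_μ,N_vN)-tiling. -/
namespace Paper

open scoped Classical

/-! ### Simulating an arbitrary neighborhood

Every tile `t` over `N` is represented by isolated unit tiles, two for each `w ∈ N`: a sender
`(w, false)` close to the reference position and a receiver `(w, true)` placed so that, in the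
copy attached to `u + w`, it lies immediately to the right of the sender of the copy attached
to `u`. The contact between the two carries the glue `t w`; all other sides of a unit tile are
free and carry its name. -/

/-- Conditions on the scale `s` and the heights `y w` of the sender–receiver pairs which make
those contacts the only ones. -/
structure IsLayout {N : Set Pos} (s : ℤ) (y : {w : Pos // w ∈ N} → ℤ) : Prop where
  four_le : 4 ≤ s
  even_scale : Even s
  even_height : ∀ w, Even (y w)
  height_inj : ∀ w w', s ∣ y w - y w' → w = w'

/-- The position, relative to the reference tile, of a unit tile. -/
def unitPos {N : Set Pos} (s : ℤ) (y : {w : Pos // w ∈ N} → ℤ)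
    (i : {w : Pos // w ∈ N} × Bool) : Pos :=
  if i.2 then (1 - s * i.1.1.1, y i.1 - s * i.1.1.2) else (0, y i.1)

/-- The glues of the simulating system: glues of the simulated one, and names of unit tiles. -/
abbrev SimGlue (X : Type) (N : Set Pos) : Type :=
  X ⊕ (Tile X N × {w : Pos // w ∈ N} × Bool)

/-- The unit tile of `t` with index `i`. -/
noncomputable def unitTile {X : Type} {N : Set Pos} (hN : IsNeighborhood N) (t : Tile X N)
    (i : {w : Pos // w ∈ N} × Bool) : Tile (SimGlue X N) Nvn := fun d =>
  if d.1 = (1, 0) ∧ i.2 = false then Sum.inl (t i.1)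
  else if d.1 = (-1, 0) ∧ i.2 = true then Sum.inl (t ⟨-i.1.1, hN.2.2 _ i.1.2⟩)
  else Sum.inr (t, i)

/-- The system of all unit tiles of tiles of `T`. -/
def unitTiles {X : Type} {N : Set Pos} (hN : IsNeighborhood N) (T : Set (Tile X N)) :
    Set (Tile (SimGlue X N) Nvn) :=
  {a | ∃ t ∈ T, ∃ i, a = unitTile hN t i}

/-- Replace every tile of `τ` by its unit tiles. -/
noncomputable def assemble {X : Type} {N : Set Pos} (hN : IsNeighborhood N) (s : ℤ)
    (y : {w : Pos // w ∈ N} → ℤ) (τ : Pos → Option (Tile X N)) :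
    Pos → Option (Tile (SimGlue X N) Nvn) := fun x =>
  if h : ∃ a u t i, τ u = some t ∧ x = sc s u + unitPos s y i ∧ a = unitTile hN t i
    then some h.choose else none

/-- The tiling with a single tile, at the origin. -/
noncomputable def single {X : Type} {N : Set Pos} (t : Tile X N) : Pos → Option (Tile X N) :=
  fun u => if u = 0 then some t else none

/-- The polyomino representing `t`. -/
noncomputable def poly {X : Type} {N : Set Pos} (hN : IsNeighborhood N) (s : ℤ)
    (y : {w : Pos // w ∈ N} → ℤ) (t : Tile X N) : Pos → Option (Tile (SimGlue X N) Nvn) :=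
  assemble hN s y (single t)

/-- The tiles of `T` all of whose unit tiles are present in `τ'` around a grid position. -/
noncomputable def decode {X : Type} {N : Set Pos} (hN : IsNeighborhood N) (s : ℤ)
    (y : {w : Pos // w ∈ N} → ℤ) (T : Set (Tile X N))
    (τ' : Pos → Option (Tile (SimGlue X N) Nvn)) : Pos → Option (Tile X N) := fun u =>
  if h : ∃ t ∈ T, ∀ i, τ' (sc s u + unitPos s y i) = some (unitTile hN t i)
    then some h.choose else none

section

variable {X : Type} {N : Set Pos} {s : ℤ} {y : {w : Pos // w ∈ N} → ℤ}

theorem IsLayout.eq_of_pos_eq (hl : IsLayout s y) {u u' : Pos}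
    {i i' : {w : Pos // w ∈ N} × Bool}
    (h : sc s u + unitPos s y i = sc s u' + unitPos s y i') : u = u' ∧ i = i' := by
  have h4 := hl.four_le
  obtain ⟨u1, u2⟩ := u
  obtain ⟨v1, v2⟩ := u'
  obtain ⟨w, b⟩ := i
  obtain ⟨w', b'⟩ := i'
  have key : ∀ z c : ℤ, s * z = c → |c| < 4 → c = 0 := fun z c hz hc =>
    Int.eq_zero_of_abs_lt_dvd ⟨z, hz.symm⟩ (lt_of_lt_of_le hc h4)
  have hs : s ≠ 0 := by omega
  cases b <;> cases b' <;> simp only [sc, unitPos, Prod.mk_add_mk, Prod.mk.injEq, if_true,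
    if_false, Bool.false_eq_true] at h <;> obtain ⟨h1, h2⟩ := h
  · obtain rfl : w = w' := hl.height_inj _ _ ⟨v2 - u2, by linear_combination h2⟩
    refine ⟨Prod.ext ?_ ?_, rfl⟩ <;> apply mul_left_cancel₀ hs <;> dsimp only <;> linarith
  · have := key (u1 - v1 + w'.1.1) 1 (by linear_combination h1) (by norm_num)
    omega
  · have := key (v1 - u1 + w.1.1) 1 (by linear_combination -h1) (by norm_num)
    omega
  · obtain rfl : w = w' := hl.height_inj _ _
      ⟨v2 - u2 + w.1.2 - w'.1.2, by linear_combination h2⟩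
    refine ⟨Prod.ext ?_ ?_, rfl⟩ <;> apply mul_left_cancel₀ hs <;> dsimp only <;> linarith

theorem IsLayout.contact (hl : IsLayout s y) {u u' d : Pos} {i i' : {w : Pos // w ∈ N} × Bool}
    (hd : d ∈ Nvn) (h : sc s u + unitPos s y i + d = sc s u' + unitPos s y i') :
    (d = (1, 0) ∧ i.2 = false ∧ i'.2 = true ∧ i.1 = i'.1 ∧ u' = u + i.1.1) ∨
      (d = (-1, 0) ∧ i.2 = true ∧ i'.2 = false ∧ i.1 = i'.1 ∧ u = u' + i.1.1) := by
  have h4 := hl.four_le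
  have hs : s ≠ 0 := by omega
  obtain ⟨k, hk⟩ := hl.even_scale
  obtain ⟨u1, u2⟩ := u
  obtain ⟨v1, v2⟩ := u'
  obtain ⟨w, b⟩ := i
  obtain ⟨w', b'⟩ := i'
  obtain ⟨c, hc⟩ := hl.even_height w
  obtain ⟨c', hc'⟩ := hl.even_height w'
  have key : ∀ z c : ℤ, s * z = c → |c| < 4 → c = 0 := fun z c hz hc =>
    Int.eq_zero_of_abs_lt_dvd ⟨z, hz.symm⟩ (lt_of_lt_of_le hc h4)
  have odd : ∀ z e : ℤ, s * z + 2 * e ≠ 1 := by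
    intro z e he
    rw [hk, show (k + k) * z + 2 * e = 2 * (k * z + e) by ring] at he
    omega
  simp only [Nvn, Set.mem_insert_iff, Set.mem_singleton_iff] at hd
  rcases hd with rfl | rfl | rfl | rfl <;> cases b <;> cases b' <;>
    simp only [sc, unitPos, Prod.mk_add_mk, Prod.mk.injEq, if_true,
      if_false, Bool.false_eq_true] at h <;> obtain ⟨h1, h2⟩ := h
  · exact absurd (by linear_combination -h2 + hc - hc') (odd (v2 - u2) (c' - c))
  · exact absurd (by linear_combination -h2 + hc - hc') (odd (v2 - u2 - w'.1.2) (c' - c))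
  · exact absurd (by linear_combination -h2 + hc - hc') (odd (v2 - u2 + w.1.2) (c' - c))
  · exact absurd (by linear_combination -h2 + hc - hc') (odd (v2 - u2 + w.1.2 - w'.1.2) (c' - c))
  · have := key (v1 - u1) 1 (by linear_combination -h1) (by norm_num)
    omega
  · obtain rfl : w = w' := hl.height_inj _ _ ⟨v2 - u2 - w'.1.2, by linear_combination h2⟩
    refine Or.inl ⟨rfl, rfl, rfl, rfl, Prod.ext ?_ ?_⟩ <;> apply mul_left_cancel₀ hs <;>
      simp only [Prod.fst_add, Prod.snd_add] <;> linarith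
  · have := key (v1 - u1 + w.1.1) 2 (by linear_combination -h1) (by norm_num)
    omega
  · have := key (v1 - u1 + w.1.1 - w'.1.1) 1 (by linear_combination -h1) (by norm_num)
    omega
  · exact absurd (by linear_combination h2 - hc + hc') (odd (u2 - v2) (c - c'))
  · exact absurd (by linear_combination h2 - hc + hc') (odd (u2 - v2 + w'.1.2) (c - c'))
  · exact absurd (by linear_combination h2 - hc + hc') (odd (u2 - v2 - w.1.2) (c - c'))
  · exact absurd (by linear_combination h2 - hc + hc') (odd (u2 - v2 - w.1.2 + w'.1.2) (c - c'))
  · have := key (u1 - v1) 1 (by linear_combination h1) (by norm_num)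
    omega
  · have := key (u1 - v1 + w'.1.1) 2 (by linear_combination h1) (by norm_num)
    omega
  · obtain rfl : w = w' := hl.height_inj _ _ ⟨v2 - u2 + w.1.2, by linear_combination h2⟩
    refine Or.inr ⟨rfl, rfl, rfl, rfl, Prod.ext ?_ ?_⟩ <;> apply mul_left_cancel₀ hs <;>
      simp only [Prod.fst_add, Prod.snd_add] <;> linarith
  · have := key (u1 - v1 - w.1.1 + w'.1.1) 1 (by linear_combination h1) (by norm_num)
    omega

theorem unitTile_injective (hN : IsNeighborhood N) {t t' : Tile X N}
    {i i' : {w : Pos // w ∈ N} × Bool} (h : unitTile hN t i = unitTile hN t' i') :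
    t = t' ∧ i = i' := by
  have := congrFun h ⟨(0, 1), by simp [Nvn]⟩
  simpa [unitTile] using this

theorem assemble_eq_some (hN : IsNeighborhood N) (hl : IsLayout s y)
    {τ : Pos → Option (Tile X N)} {x : Pos} {a : Tile (SimGlue X N) Nvn} :
    assemble hN s y τ x = some a ↔
      ∃ u t i, τ u = some t ∧ x = sc s u + unitPos s y i ∧ a = unitTile hN t i := by
  unfold assemble
  split_ifs with h
  · obtain ⟨u, t, i, hu, hx, ha⟩ := h.choose_spec
    rw [Option.some.injEq]
    constructor
    · rintro rfl
      exact ⟨u, t, i, hu, hx, ha⟩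
    · rintro ⟨u', t', i', hu', hx', rfl⟩
      obtain ⟨rfl, rfl⟩ := hl.eq_of_pos_eq (hx.symm.trans hx')
      obtain rfl : t = t' := by simpa [hu] using hu'
      exact ha
  · exact ⟨fun h' => by simp at h', fun h' => absurd ⟨a, h'⟩ h⟩

theorem poly_eq_some (hN : IsNeighborhood N) (hl : IsLayout s y)
    {t : Tile X N} {x : Pos} {a : Tile (SimGlue X N) Nvn} :
    poly hN s y t x = some a ↔ ∃ i, x = unitPos s y i ∧ a = unitTile hN t i := by
  have h0 : ∀ p : Pos, sc s 0 + p = p := fun p => by simp [sc]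
  rw [poly, assemble_eq_some hN hl]
  constructor
  · rintro ⟨u, t', i, hu, hx, ha⟩
    obtain ⟨rfl, rfl⟩ : u = 0 ∧ t = t' := by simpa [single] using hu
    exact ⟨i, hx.trans (h0 _), ha⟩
  · rintro ⟨i, hx, ha⟩
    exact ⟨0, t, i, by simp [single], hx.trans (h0 _).symm, ha⟩

theorem poly_subset_iff (hN : IsNeighborhood N) (hl : IsLayout s y) {t : Tile X N} {u : Pos}
    {τ' : Pos → Option (Tile (SimGlue X N) Nvn)} :
    (∀ p a, poly hN s y t p = some a → τ' (sc s u + p) = some a) ↔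
      ∀ i, τ' (sc s u + unitPos s y i) = some (unitTile hN t i) := by
  constructor
  · exact fun h i => h _ _ ((poly_eq_some hN hl).2 ⟨i, rfl, rfl⟩)
  · intro h p a hp
    obtain ⟨i, rfl, rfl⟩ := (poly_eq_some hN hl).1 hp
    exact h i

theorem isTiling_assemble (hN : IsNeighborhood N) (hl : IsLayout s y) {T : Set (Tile X N)}
    {τ : Pos → Option (Tile X N)} (hτ : IsTiling T τ) :
    IsTiling (unitTiles hN T) (assemble hN s y τ) := by
  constructor
  · intro p a hp
    obtain ⟨u, t, i, hu, -, ha⟩ := (assemble_eq_some hN hl).1 hp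
    exact ⟨t, hτ.1 _ _ hu, i, ha⟩
  · intro p a hp d a' hp' hd hd'
    obtain ⟨u, t, ⟨w, b⟩, hu, rfl, rfl⟩ := (assemble_eq_some hN hl).1 hp
    obtain ⟨u', t', ⟨w', b'⟩, hu', hx, rfl⟩ := (assemble_eq_some hN hl).1 hp'
    rcases hl.contact hd hx with ⟨rfl, rfl, rfl, rfl, rfl⟩ | ⟨rfl, rfl, rfl, rfl, rfl⟩
    · simpa [unitTile] using hτ.2 u t hu w.1 t' hu' w.2 (hN.2.2 _ w.2)
    · simpa [unitTile] using (hτ.2 u' t' hu' w.1 t hu w.2 (hN.2.2 _ w.2)).symm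

theorem isTiling_single (hN : IsNeighborhood N) {T : Set (Tile X N)} {t : Tile X N}
    (ht : t ∈ T) : IsTiling T (single t) := by
  constructor
  · intro p t' hp
    obtain ⟨-, rfl⟩ : p = 0 ∧ t = t' := by simpa [single] using hp
    exact ht
  · intro p t₁ hp w t₂ hp' hw
    obtain ⟨rfl, -⟩ : p = 0 ∧ t = t₁ := by simpa [single] using hp
    obtain ⟨rfl, -⟩ : w = 0 ∧ t = t₂ := by simpa [single] using hp'
    exact absurd hw hN.2.1

theorem isFiniteTiling_poly (hN : IsNeighborhood N) (hl : IsLayout s y) {T : Set (Tile X N)}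
    {t : Tile X N} (ht : t ∈ T) : IsFiniteTiling (unitTiles hN T) (poly hN s y t) := by
  refine ⟨isTiling_assemble hN hl (isTiling_single hN ht), ?_⟩
  have : Finite {w : Pos // w ∈ N} := hN.1
  refine (Set.finite_range (unitPos s y)).subset fun p hp => ?_
  obtain ⟨a, ha⟩ := Option.ne_none_iff_exists'.1 hp
  obtain ⟨i, rfl, -⟩ := (poly_eq_some hN hl).1 ha
  exact ⟨i, rfl⟩

theorem isPolyTiling_map_poly (hN : IsNeighborhood N) (hl : IsLayout s y) {T : Set (Tile X N)}
    {τ : Pos → Option (Tile X N)} (hτ : IsTiling T τ) :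
    IsPolyTiling (unitTiles hN T) s (fun u => (τ u).map (poly hN s y)) := by
  simp only [IsPolyTiling, Option.map_eq_some_iff]
  refine ⟨?_, ?_, ?_⟩
  · rintro u _ ⟨t, hu, rfl⟩
    exact isFiniteTiling_poly hN hl (hτ.1 _ _ hu)
  · rintro u v _ _ huv ⟨t, hu, rfl⟩ ⟨t', hv, rfl⟩ p hp q hq h
    obtain ⟨a, ha⟩ := Option.ne_none_iff_exists'.1 hp
    obtain ⟨b, hb⟩ := Option.ne_none_iff_exists'.1 hq
    obtain ⟨i, rfl, -⟩ := (poly_eq_some hN hl).1 ha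
    obtain ⟨j, rfl, -⟩ := (poly_eq_some hN hl).1 hb
    exact huv (hl.eq_of_pos_eq h).1
  · have mem : ∀ u t v a, τ u = some t → poly hN s y t v = some a →
        assemble hN s y τ (sc s u + v) = some a := by
      intro u t v a hu hv
      obtain ⟨i, rfl, rfl⟩ := (poly_eq_some hN hl).1 hv
      exact (assemble_eq_some hN hl).2 ⟨u, t, i, hu, rfl, rfl⟩
    rintro u u' _ _ ⟨t, hu, rfl⟩ ⟨t', hu', rfl⟩ v a hv v' a' hv' hw hw'
    refine (isTiling_assemble hN hl hτ).2 _ a (mem u t v a hu hv) _ a' ?_ hw hw'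
    rw [add_sub_cancel]
    exact mem u' t' v' a' hu' hv'

theorem decode_eq_some (hN : IsNeighborhood N) (h0 : N.Nonempty) {T : Set (Tile X N)}
    {τ' : Pos → Option (Tile (SimGlue X N) Nvn)} {u : Pos} {t : Tile X N} :
    decode hN s y T τ' u = some t ↔
      t ∈ T ∧ ∀ i, τ' (sc s u + unitPos s y i) = some (unitTile hN t i) := by
  unfold decode
  split_ifs with h
  · rw [Option.some.injEq]
    constructor
    · rintro rfl
      exact h.choose_spec
    · intro ht
      obtain ⟨w, hw⟩ := h0
      have h1 := h.choose_spec.2 (⟨w, hw⟩, false)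
      rw [ht.2] at h1
      exact (unitTile_injective hN (Option.some.inj h1)).1.symm
  · exact ⟨fun h' => by simp at h', fun h' => absurd ⟨t, h'⟩ h⟩

theorem isTiling_decode (hN : IsNeighborhood N) (h0 : N.Nonempty) {T : Set (Tile X N)}
    {τ' : Pos → Option (Tile (SimGlue X N) Nvn)} (hτ' : IsTiling (unitTiles hN T) τ') :
    IsTiling T (decode hN s y T τ') := by
  refine ⟨fun p t hp => ((decode_eq_some hN h0).1 hp).1, fun u t hu w t' hu' hw hw' => ?_⟩
  have h1 := ((decode_eq_some hN h0).1 hu).2 (⟨w, hw⟩, false)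
  have h2 := ((decode_eq_some hN h0).1 hu').2 (⟨w, hw⟩, true)
  have hpos : sc s (u + w) + unitPos s y (⟨w, hw⟩, true) =
      sc s u + unitPos s y (⟨w, hw⟩, false) + (1, 0) := by
    ext <;> simp [sc, unitPos] <;> ring
  rw [hpos] at h2
  simpa [unitTile] using hτ'.2 _ _ h1 (1, 0) _ h2 (by simp [Nvn]) (by simp [Nvn])

theorem decode_assemble (hN : IsNeighborhood N) (h0 : N.Nonempty) (hl : IsLayout s y)
    {T : Set (Tile X N)} {τ : Pos → Option (Tile X N)} (hτ : IsTiling T τ) :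
    decode hN s y T (assemble hN s y τ) = τ := by
  ext u t
  rw [decode_eq_some hN h0]
  constructor
  · rintro ⟨-, h⟩
    obtain ⟨w, hw⟩ := h0
    obtain ⟨u', t', i, hu, hx, ht⟩ := (assemble_eq_some hN hl).1 (h (⟨w, hw⟩, false))
    rw [(hl.eq_of_pos_eq hx).1, (unitTile_injective hN ht).1]
    exact hu
  · exact fun hu => ⟨hτ.1 _ _ hu, fun i =>
      (assemble_eq_some hN hl).2 ⟨u, t, i, hu, rfl, rfl⟩⟩

theorem poly_injective (hN : IsNeighborhood N) (h0 : N.Nonempty) (hl : IsLayout s y) :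
    Function.Injective (poly (X := X) hN s y) := by
  intro t t' h
  obtain ⟨w, hw⟩ := h0
  have h1 := (poly_eq_some hN hl (t := t)).2 ⟨(⟨w, hw⟩, false), rfl, rfl⟩
  rw [h] at h1
  obtain ⟨i, -, hi⟩ := (poly_eq_some hN hl).1 h1
  exact (unitTile_injective hN hi).1

/-- The simulation of `T` by its unit tiles. -/
noncomputable def unitSimulation (hN : IsNeighborhood N) (hl : IsLayout s y)
    (w₀ : {w : Pos // w ∈ N}) (hw₀ : y w₀ = 0) (T : Set (Tile X N)) :
    TilingSimulation X (SimGlue X N) N T (unitTiles hN T) s where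
  hs := by linarith [hl.four_le]
  phi t := {σ | t ∈ T ∧ σ = poly hN s y t}
  phi_fin := by
    rintro t _ ⟨ht, rfl⟩
    exact isFiniteTiling_poly hN hl ht
  phi_ref := by
    rintro t _ ⟨ht, rfl⟩
    exact Option.ne_none_iff_exists'.2 ⟨_, (poly_eq_some hN hl).2
      ⟨(w₀, false), by simp [unitPos, hw₀], rfl⟩⟩
  phi_spec := by
    rintro t t' htt _ ⟨-, rfl⟩ _ ⟨-, rfl⟩ p q a b hp hq rfl
    obtain ⟨i, -, hi⟩ := (poly_eq_some hN hl).1 hp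
    obtain ⟨j, -, hj⟩ := (poly_eq_some hN hl).1 hq
    exact htt (unitTile_injective hN (hi.symm.trans hj)).1
  chi τ' u := (decode hN s y T τ' u).map (poly hN s y)
  chi_poly τ' hτ' := isPolyTiling_map_poly hN hl (isTiling_decode hN ⟨_, w₀.2⟩ hτ')
  chi_sub := by
    intro τ' u σ h
    obtain ⟨t, ht, rfl⟩ := Option.map_eq_some_iff.1 h
    obtain ⟨htT, hi⟩ := (decode_eq_some hN ⟨_, w₀.2⟩).1 ht
    exact ⟨⟨t, htT, htT, rfl⟩, (poly_subset_iff hN hl).2 hi⟩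
  chi_max := by
    rintro τ' t ht _ ⟨-, rfl⟩ u h
    rw [(decode_eq_some hN ⟨_, w₀.2⟩).2 ⟨ht, (poly_subset_iff hN hl).1 h⟩]
    simp
  psi τ := {fun u => (τ u).map (poly hN s y)}
  psi_nonempty _ _ := Set.singleton_nonempty _
  psi_poly := by
    rintro τ hτ _ rfl
    exact isPolyTiling_map_poly hN hl hτ
  psi_dom := by
    rintro τ - _ rfl u
    simp
  psi_comp := by
    rintro τ hτ _ rfl u t hu σ hσ
    obtain rfl : poly hN s y t = σ := by simpa [hu] using hσ
    exact ⟨hτ.1 _ _ hu, rfl⟩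
  psi_recover τ' hτ' :=
    ⟨decode hN s y T τ', ⟨isTiling_decode hN ⟨_, w₀.2⟩ hτ', rfl⟩, fun _ h =>
      funext fun u => Option.map_injective (poly_injective hN ⟨_, w₀.2⟩ hl)
        (congrFun h.2 u).symm⟩

end

theorem exists_isLayout {N : Set Pos} (hN : IsNeighborhood N) (w₀ : {w : Pos // w ∈ N}) :
    ∃ (s : ℤ) (y : {w : Pos // w ∈ N} → ℤ), IsLayout s y ∧ y w₀ = 0 := by
  have : Finite {w : Pos // w ∈ N} := hN.1
  obtain ⟨k, ⟨e⟩⟩ := Finite.exists_equiv_fin {w : Pos // w ∈ N}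
  have hk : 0 < k := (Nat.zero_le _).trans_lt (e w₀).2
  refine ⟨2 * (k + 1), fun w => 2 * ((e w : ℕ) - (e w₀ : ℕ)),
    ⟨by omega, even_two_mul _, fun _ => even_two_mul _, ?_⟩, by simp⟩
  rintro w w' h
  have h1 := (e w).2
  have h2 := (e w').2
  have h3 := Int.eq_zero_of_abs_lt_dvd h (by rw [abs_lt]; constructor <;> omega)
  exact e.injective (Fin.ext (by omega))

theorem isNeighborhood_Nrect (m n : ℤ) : IsNeighborhood (Nrect m n) := by
  refine ⟨(Set.finite_Icc ((-m, -n) : Pos) (m, n)).subset ?_, fun h => h.2.2 rfl, ?_⟩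
  · rintro ⟨a, b⟩ ⟨h1, h2, -⟩
    rw [abs_le] at h1 h2
    exact ⟨⟨h1.1, h2.1⟩, ⟨h1.2, h2.2⟩⟩
  · rintro w ⟨h1, h2, h3⟩
    exact ⟨by simpa using h1, by simpa using h2, neg_ne_zero.2 h3⟩

/-- simulation of rectangular-neighborhood tilings by von
Neumann-neighborhood tilings. -/
theorem stmt9 (X : Type) [Fintype X] (m n : ℤ) (hm : 1 ≤ m) (hn : 1 ≤ n)
    (T : Set (Tile X (Nrect m n))) (hT : T.Finite) :
    ∃ (Xμ : Type) (_ : Fintype Xμ) (Tμ : Set (Tile Xμ Nvn)) (_ : Tμ.Finite)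
      (s : ℤ) (sim : TilingSimulation X Xμ (Nrect m n) T Tμ s),
      ∀ τ, IsTiling T τ → ∃ τ', IsTiling Tμ τ' ∧ sim.chi τ' ∈ sim.psi τ := by
  have hN := isNeighborhood_Nrect m n
  have : Finite {w : Pos // w ∈ Nrect m n} := hN.1
  let w₀ : {w : Pos // w ∈ Nrect m n} :=
    ⟨(1, 0), by simpa using hm, by simpa using (zero_le_one.trans hn), by simp⟩
  obtain ⟨s, y, hl, hy⟩ := exists_isLayout hN w₀
  refine ⟨SimGlue X (Nrect m n), Fintype.ofFinite _, unitTiles hN T, ?_, s,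
    unitSimulation hN hl w₀ hy T, fun τ hτ => ⟨assemble hN s y τ, isTiling_assemble hN hl hτ, ?_⟩⟩
  · have : Finite {d : Pos // d ∈ Nvn} := Set.Finite.to_subtype (by simp [Nvn])
    exact Set.toFinite _
  · change _ = _
    simp only [unitSimulation]
    rw [decode_assemble hN ⟨_, w₀.2⟩ hl hτ]

end Paper
end
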